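/- arXiv:math/0511642 — 2 statements merged into one kernel-verified Lean document; each statement's English description precedes it below -/
import Mathlib

section
/- Let k be a field, n, l ≥ 1, R = k[x_{ij} : 1 ≤ i ≤ n, 1 ≤ j ≤ ln] the polynomial ring in ln² variables graded with each x_{ij} of degree 1, X = (x_{ij}) the generic n × (ln) matrix, and F the graded R-module R^n / ⟨columns of X⟩ (generators of R^n in degree 0). Then the Hilbert series of F satisfies the power series identity Σ_{m≥0} dim_k(F_m) t^m = [ Σ_{i=0}^{n−1} C(ln, i) (n−i) t^i (1−t)^{n−1−i} ] / (1−t)^{ln² − (l−1)n − 1}, where F_m is the degree-m homogeneous component of F and C(a,b) denotes a binomial coefficient. -/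
noncomputable section

/-- The generic `n × (l*n)` matrix of indeterminates. -/
def genMatrix (k : Type) [Field k] (n m : ℕ) :
    Matrix (Fin n) (Fin m) (MvPolynomial (Fin n × Fin m) k) :=
  Matrix.of fun i j => MvPolynomial.X (i, j)

/-- The cokernel `F = Rⁿ / ⟨columns of X⟩` of the generic `n × m` matrix. -/
abbrev genCoker (k : Type) [Field k] (n m : ℕ) :=
  (Fin n → MvPolynomial (Fin n × Fin m) k) ⧸
    LinearMap.range (Matrix.mulVecLin (genMatrix k n m))

/-- The degree-`q` homogeneous component of `F`, as a `k`-subspace: the image of the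
`q`-th homogeneous component of `Rⁿ` in the quotient. -/
def genCokerComp (k : Type) [Field k] (n m : ℕ) (q : ℕ) :
    Submodule k (genCoker k n m) :=
  Submodule.map
    (LinearMap.restrictScalars k
      (Submodule.mkQ (LinearMap.range (Matrix.mulVecLin (genMatrix k n m)))))
    (Submodule.pi Set.univ
      (fun _ : Fin n => MvPolynomial.homogeneousSubmodule (Fin n × Fin m) k q))

/-- The Hilbert series `∑ q, dim_k F_q · t^q ∈ ℤ[[t]]` of `F`. -/
def genCokerHilbert (k : Type) [Field k] (n m : ℕ) : PowerSeries ℤ :=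
  PowerSeries.mk fun q => (Module.finrank k (genCokerComp k n m q) : ℤ)

end

section PowerSeriesIdentities

open PowerSeries

lemma sum_choose_pascal (A : Type*) [CommRing A] (u : A) (m n : ℕ) :
    (1 + u) * ∑ i ∈ Finset.range (n + 1), (m.choose i : A) * u ^ i =
      ∑ i ∈ Finset.range (n + 1), ((m + 1).choose i : A) * u ^ i + m.choose n * u ^ (n + 1) := by
  induction n with
  | zero => simp
  | succ n ih =>
    rw [Finset.sum_range_succ, mul_add, ih, Finset.sum_range_succ _ (n + 1), Nat.choose_succ_succ]
    push_cast
    ring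

lemma weighted_sum_choose_succ {A : Type*} [CommRing A] (u : A) (m n : ℕ) :
    ∑ i ∈ Finset.range (n + 1), ((m.choose i * (n + 1 - i) : ℕ) : A) * u ^ i =
      ∑ i ∈ Finset.range n, ((m.choose i * (n - i) : ℕ) : A) * u ^ i +
        ∑ i ∈ Finset.range (n + 1), (m.choose i : A) * u ^ i := by
  rw [Finset.sum_range_succ, Finset.sum_range_succ _ n, ← add_assoc, ← Finset.sum_add_distrib]
  congr 1
  · refine Finset.sum_congr rfl fun i hi => ?_
    rw [Nat.succ_sub (Finset.mem_range.1 hi).le]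
    push_cast
    ring
  · simp

lemma weighted_sum_choose_pascal {A : Type*} [CommRing A] (u : A) (m n : ℕ) :
    (1 + u) * ∑ i ∈ Finset.range n, ((m.choose i * (n - i) : ℕ) : A) * u ^ i =
      ∑ i ∈ Finset.range n, (((m + 1).choose i * (n - i) : ℕ) : A) * u ^ i +
        u * ∑ i ∈ Finset.range n, (m.choose i : A) * u ^ i := by
  induction n with
  | zero => simp
  | succ n ih =>
    rw [weighted_sum_choose_succ, weighted_sum_choose_succ, mul_add, ih, sum_choose_pascal,
      Finset.sum_range_succ (fun i => (m.choose i : A) * u ^ i)]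
    ring

/-- The geometric series `1 / (1 - t)`. -/
noncomputable def geomSeries : PowerSeries ℤ := PowerSeries.mk 1

lemma geomSeries_eq : geomSeries = 1 + X * geomSeries := by
  have h : geomSeries * (1 - X) = 1 := PowerSeries.mk_one_mul_one_sub_eq_one ℤ
  linear_combination h

lemma telescoping_identity (n M m : ℕ) (hn : 1 ≤ n) (hm : m ≤ M) :
    (n : PowerSeries ℤ) * geomSeries ^ (n * M) =
      (∑ i ∈ Finset.range n, ((m.choose i * (n - i) : ℕ) : PowerSeries ℤ) *
        (X * geomSeries) ^ i) * geomSeries ^ (n * M - m) +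
      X * ∑ r ∈ Finset.range m, (∑ i ∈ Finset.range n, (r.choose i : PowerSeries ℤ) *
        (X * geomSeries) ^ i) * geomSeries ^ (n * M - r) := by
  induction m with
  | zero =>
    obtain ⟨n, rfl⟩ := Nat.exists_eq_add_of_le' hn
    rw [Finset.sum_range_succ']
    simp
  | succ m ih =>
    rw [ih (by omega), Finset.sum_range_succ _ m]
    have hle : M ≤ n * M := Nat.le_mul_of_pos_left M hn
    obtain ⟨d, hd⟩ : ∃ d, n * M = m + 1 + d := ⟨n * M - (m + 1), by omega⟩
    have h1 : n * M - m = d + 1 := by omega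
    have h2 : n * M - (m + 1) = d := by omega
    have key := weighted_sum_choose_pascal (X * geomSeries) m n
    rw [← geomSeries_eq] at key
    rw [h1, h2]
    linear_combination geomSeries ^ d * key

open Finset in
/-- Monomials of degree `q`, weighted by a function of the number of variables
they involve among those in row `0` and columns `T`. -/
lemma sum_weight_finsuppAntidiag {n M : ℕ} [NeZero n] (T : Finset (Fin M)) (φ : ℕ → ℤ) (q : ℕ) :
    ∑ α ∈ (univ : Finset (Fin n × Fin M)).finsuppAntidiag q,
        φ (#{j ∈ T | α (0, j) ≠ 0}) =
      PowerSeries.coeff q ((∑ i ∈ range (#T + 1), ((#T).choose i * φ i : PowerSeries ℤ) *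
        (X * geomSeries) ^ i) * geomSeries ^ (n * M - #T)) := by
  classical
  have key : ∀ S ∈ T.powerset, ∑ α ∈ (univ : Finset (Fin n × Fin M)).finsuppAntidiag q,
      (if {j ∈ T | α (0, j) ≠ 0} = S then (1 : ℤ) else 0) =
      PowerSeries.coeff q ((X * geomSeries) ^ #S * geomSeries ^ (n * M - #T)) := by
    intro S hS
    rw [mem_powerset] at hS
    let f : Fin n × Fin M → PowerSeries ℤ := fun p =>
      if p.1 = 0 ∧ p.2 ∈ T then (if p.2 ∈ S then X * geomSeries else 1) else geomSeries
    have hf : ∏ p, f p = (X * geomSeries) ^ #S * geomSeries ^ (n * M - #T) := by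
      have hT : #{p : Fin n × Fin M | p.1 = 0 ∧ p.2 ∈ T} = #T := by
        rw [show ({p : Fin n × Fin M | p.1 = 0 ∧ p.2 ∈ T} : Finset _) = {0} ×ˢ T by
          ext; simp only [mem_filter, mem_univ, true_and, mem_product, mem_singleton],
          card_product]
        simp
      have hTS : #{p ∈ ({p : Fin n × Fin M | p.1 = 0 ∧ p.2 ∈ T} : Finset _) | p.2 ∈ S} = #S := by
        rw [show ({p ∈ ({p : Fin n × Fin M | p.1 = 0 ∧ p.2 ∈ T} : Finset _) | p.2 ∈ S}) =
          {0} ×ˢ S by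
            ext p
            simp only [mem_filter, mem_univ, true_and, mem_product, mem_singleton, and_assoc]
            exact and_congr_right fun _ => and_iff_right_of_imp fun h => hS h, card_product]
        simp
      simp only [f]
      rw [prod_ite, prod_const, prod_ite, prod_const, prod_const_one, mul_one, hTS,
        filter_not, card_sdiff_of_subset (filter_subset _ _), hT]
      simp
    rw [← hf, PowerSeries.coeff_prod]
    refine sum_congr rfl fun α _ => ?_
    have hc : ∀ p, PowerSeries.coeff (α p) (f p) =
        if p.1 = 0 ∧ p.2 ∈ T → (α p ≠ 0 ↔ p.2 ∈ S) then 1 else 0 := by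
      intro p
      by_cases h : p.1 = 0 ∧ p.2 ∈ T
      · by_cases hs : p.2 ∈ S <;> rcases hα : α p with _ | e <;>
          simp [f, h, hs, geomSeries, PowerSeries.coeff_succ_X_mul, PowerSeries.coeff_one]
      · simp [f, h, geomSeries]
    simp only [hc]
    rw [prod_ite_zero]
    simp only [prod_const_one]
    congr 1
    simp only [mem_univ, true_imp_iff, eq_iff_iff, Prod.forall, Finset.ext_iff, mem_filter]
    constructor
    · rintro h i j ⟨rfl, hj⟩
      simpa [hj] using h j
    · intro h j
      constructor
      · exact fun hj => (h 0 j ⟨rfl, hj.1⟩).1 hj.2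
      · exact fun hj => ⟨hS hj, (h 0 j ⟨rfl, hS hj⟩).2 hj⟩
  have h1 : ∀ α : Fin n × Fin M →₀ ℕ, φ (#{j ∈ T | α (0, j) ≠ 0}) =
      ∑ S ∈ T.powerset, φ (#S) * (if {j ∈ T | α (0, j) ≠ 0} = S then (1 : ℤ) else 0) := by
    intro α
    simp
  simp only [h1]
  rw [sum_comm]
  simp only [← mul_sum]
  rw [sum_congr rfl fun S hS => by rw [key S hS],
    sum_powerset_apply_card (fun c => φ c *
      PowerSeries.coeff q ((X * geomSeries) ^ c * geomSeries ^ (n * M - #T))), sum_mul, map_sum]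
  refine sum_congr rfl fun i _ => ?_
  rw [show (((#T).choose i : PowerSeries ℤ) * (φ i : PowerSeries ℤ) * (X * geomSeries) ^ i *
    geomSeries ^ (n * M - #T)) = PowerSeries.C ((#T).choose i * φ i : ℤ) * ((X * geomSeries) ^ i *
    geomSeries ^ (n * M - #T)) by simp; ring, PowerSeries.coeff_C_mul, nsmul_eq_mul]
  ring

end PowerSeriesIdentities

section Spanning

open MvPolynomial Finset

variable {K : Type} [Field K] {n M : ℕ}

/-- The degree-`q` homogeneous component of the free module `Rⁿ`. -/
noncomputable abbrev homogeneousVectors (K : Type) [Field K] (n M q : ℕ) :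
    Submodule K (Fin n → MvPolynomial (Fin n × Fin M) K) :=
  Submodule.pi Set.univ (fun _ : Fin n => homogeneousSubmodule (Fin n × Fin M) K q)

/-- The submodule of `Rⁿ` spanned by the first `m` columns of the generic matrix. -/
noncomputable def columnSpan (K : Type) [Field K] (n M m : ℕ) :
    Submodule (MvPolynomial (Fin n × Fin M) K) (Fin n → MvPolynomial (Fin n × Fin M) K) :=
  Submodule.span _ ((genMatrix K n M).col '' {j | (j : ℕ) < m})

lemma columnSpan_self :
    columnSpan K n M M = LinearMap.range (Matrix.mulVecLin (genMatrix K n M)) := by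
  rw [Matrix.range_mulVecLin, columnSpan, ← Set.image_univ]
  congr 2
  ext j
  simp

lemma col_mem_columnSpan {m : ℕ} {j : Fin M} (hj : (j : ℕ) < m) :
    (genMatrix K n M).col j ∈ columnSpan K n M m :=
  Submodule.subset_span ⟨j, hj, rfl⟩

variable [NeZero n]

/-- The linear form `x_{ij} - s_j ^ i x_{0j}` for `i ≠ 0`, and `x_{0j}` for `i = 0`. -/
noncomputable def shiftedVar (s : Fin M → K) (p : Fin n × Fin M) : MvPolynomial (Fin n × Fin M) K :=
  if p.1 = 0 then X p else X p - C (s p.2 ^ (p.1 : ℕ)) * X (0, p.2)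

/-- Monomials in the linear forms `shiftedVar`. -/
noncomputable def shiftedMonomial (s : Fin M → K) (α : Fin n × Fin M →₀ ℕ) :
    MvPolynomial (Fin n × Fin M) K :=
  α.prod fun p e => shiftedVar s p ^ e

lemma shiftedVar_zero (s : Fin M → K) (j : Fin M) :
    shiftedVar s ((0 : Fin n), j) = X (0, j) := by
  simp [shiftedVar]

lemma X_eq_shiftedVar_add (s : Fin M → K) {i : Fin n} (hi : i ≠ 0) (j : Fin M) :
    (X (i, j) : MvPolynomial (Fin n × Fin M) K) =
      shiftedVar s (i, j) + C (s j ^ (i : ℕ)) * X (0, j) := by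
  simp [shiftedVar, hi]

lemma shiftedVar_mem (s : Fin M → K) (p : Fin n × Fin M) :
    shiftedVar s p ∈ homogeneousSubmodule (Fin n × Fin M) K 1 := by
  unfold shiftedVar
  split_ifs
  · exact isHomogeneous_X _ _
  · exact Submodule.sub_mem _ (isHomogeneous_X K p) (isHomogeneous_C_mul_X _ _)

lemma shiftedMonomial_add (s : Fin M → K) (α β : Fin n × Fin M →₀ ℕ) :
    shiftedMonomial s (α + β) = shiftedMonomial s α * shiftedMonomial s β :=
  Finsupp.prod_add_index' (by simp) (by simp [pow_add])

lemma shiftedMonomial_single (s : Fin M → K) (p : Fin n × Fin M) :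
    shiftedMonomial s (Finsupp.single p 1) = shiftedVar s p := by
  simp [shiftedMonomial]

lemma shiftedMonomial_mem (s : Fin M → K) (α : Fin n × Fin M →₀ ℕ) :
    shiftedMonomial s α ∈ homogeneousSubmodule (Fin n × Fin M) K α.degree := by
  have h : ∀ p ∈ α.support, (shiftedVar s p ^ α p).IsHomogeneous (α p) := fun p _ => by
    simpa using (show (shiftedVar s p).IsHomogeneous 1 from shiftedVar_mem s p).pow (α p)
  exact IsHomogeneous.prod _ _ _ h

lemma exists_eq_add_single {σ : Type*} {q : ℕ} {α : σ →₀ ℕ} (h : α.degree = q + 1) :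
    ∃ p β, α = β + Finsupp.single p 1 ∧ β.degree = q := by
  have hne : α ≠ 0 := by rintro rfl; simp at h
  obtain ⟨p, hp⟩ := Finsupp.ne_iff.1 hne
  have h1 : α = (α - Finsupp.single p 1) + Finsupp.single p 1 :=
    (tsub_add_cancel_of_le (Finsupp.single_le_iff.2 (Nat.one_le_iff_ne_zero.2 hp))).symm
  refine ⟨p, _, h1, ?_⟩
  rw [h1, map_add, Finsupp.degree_single] at h
  omega

lemma homogeneousSubmodule_le_span_shiftedMonomial (s : Fin M → K) (q : ℕ) :
    homogeneousSubmodule (Fin n × Fin M) K q ≤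
      Submodule.span K (shiftedMonomial s '' {α | α.degree = q}) := by
  have mul_mem : ∀ q (p : Fin n × Fin M) f,
      f ∈ Submodule.span K (shiftedMonomial s '' {α | α.degree = q}) →
      f * shiftedVar s p ∈ Submodule.span K (shiftedMonomial s '' {α | α.degree = q + 1}) := by
    intro q p f hf
    induction hf using Submodule.span_induction with
    | mem f hf =>
      obtain ⟨α, hα, rfl⟩ := hf
      refine Submodule.subset_span ⟨α + Finsupp.single p 1, ?_, ?_⟩
      · simp [show α.degree = q from hα]
      · rw [shiftedMonomial_add, shiftedMonomial_single]
    | zero => simp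
    | add f g _ _ hf hg => rw [add_mul]; exact add_mem hf hg
    | smul a f _ hf => rw [smul_mul_assoc]; exact Submodule.smul_mem _ _ hf
  have mono_mem : ∀ q (α : Fin n × Fin M →₀ ℕ), α.degree = q →
      monomial α (1 : K) ∈ Submodule.span K (shiftedMonomial s '' {α | α.degree = q}) := by
    intro q
    induction q with
    | zero =>
      intro α hα
      rw [Finsupp.degree_eq_zero_iff] at hα
      subst hα
      exact Submodule.subset_span ⟨0, by simp, by simp [shiftedMonomial]⟩
    | succ q ih =>
      intro α hα
      obtain ⟨⟨i, j⟩, β, rfl, hβ⟩ := exists_eq_add_single hα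
      rw [monomial_add_single, pow_one]
      by_cases hi : i = 0
      · subst hi
        rw [← shiftedVar_zero s]
        exact mul_mem _ _ _ (ih β hβ)
      · rw [X_eq_shiftedVar_add s hi, mul_add, ← shiftedVar_zero s, ← smul_eq_C_mul, mul_smul_comm]
        exact add_mem (mul_mem _ _ _ (ih β hβ)) (Submodule.smul_mem _ _ (mul_mem _ _ _ (ih β hβ)))
  intro f hf
  rw [f.as_sum]
  refine Submodule.sum_mem _ fun α hα => ?_
  rw [← mul_one (coeff α f), ← smul_eq_mul, ← smul_monomial]
  refine Submodule.smul_mem _ _ (mono_mem q α ?_)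
  rw [Finsupp.degree_eq_weight_one]
  exact hf (mem_support_iff.1 hα)

omit [NeZero n] in
lemma homogeneousVectors_le {q : ℕ} {U : Submodule K (Fin n → MvPolynomial (Fin n × Fin M) K)}
    {S : Set (MvPolynomial (Fin n × Fin M) K)}
    (hS : homogeneousSubmodule (Fin n × Fin M) K q ≤ Submodule.span K S)
    (h : ∀ i, ∀ f ∈ S, Pi.single i f ∈ U) : homogeneousVectors K n M q ≤ U := by
  intro v hv
  rw [← Finset.univ_sum_single v]
  refine Submodule.sum_mem _ fun i _ => ?_
  have : Submodule.span K S ≤ U.comap (LinearMap.single K _ i) :=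
    Submodule.span_le.2 fun f hf => h i f hf
  exact this (hS (hv i trivial))

/-- The columns of a Vandermonde matrix with `r` distinct nodes span the coordinate vectors
`e_i`, `i < r`, modulo the coordinate vectors `e_i`, `i ≥ r`. -/
lemma exists_vandermonde_combination {s : Fin M → K} (hs : Function.Injective s)
    (S : Finset (Fin M)) {i : ℕ} (hi : i < #S) :
    ∃ c : Fin M → K, ∀ i' < #S, ∑ j ∈ S, c j * s j ^ i' = if i' = i then 1 else 0 := by
  classical
  let e := S.orderEmbOfFin rfl
  have hdet : IsUnit (Matrix.vandermonde (s ∘ e)).det :=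
    (Matrix.det_vandermonde_ne_zero_iff.2 (hs.comp e.injective)).isUnit
  let B := (Matrix.vandermonde (s ∘ e))⁻¹
  have hB : B * Matrix.vandermonde (s ∘ e) = 1 := Matrix.nonsing_inv_mul _ hdet
  refine ⟨Function.extend e (B ⟨i, hi⟩) 0, fun i' hi' => ?_⟩
  have himg : S = univ.map e.toEmbedding := by
    rw [← Finset.coe_inj]; simp [e]
  have := congrFun (congrFun hB ⟨i, hi⟩) ⟨i', hi'⟩
  rw [Matrix.mul_apply, Matrix.one_apply] at this
  rw [sum_congr himg fun _ _ => rfl, sum_map]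
  simp only [RelEmbedding.coe_toEmbedding, e.injective.extend_apply]
  simpa [Matrix.vandermonde, Fin.ext_iff, eq_comm] using this

/-- The set of columns `j < m` whose entry in row `0` divides the monomial `α`. -/
def topSupport (m : ℕ) (α : Fin n × Fin M →₀ ℕ) : Finset (Fin M) :=
  {j ∈ ({j | (j : ℕ) < m} : Finset (Fin M)) | α (0, j) ≠ 0}

lemma topSupport_add_single (m : ℕ) (α : Fin n × Fin M →₀ ℕ) {p : Fin n × Fin M} (hp : p.1 ≠ 0) :
    topSupport m (α + Finsupp.single p 1) = topSupport m α := by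
  have (j : Fin M) : Finsupp.single p 1 ((0 : Fin n), j) = 0 :=
    Finsupp.single_eq_of_ne fun h => hp (by rw [← h])
  simp [topSupport, this]

/-- The vectors `w^α e_i` with `i` at least the number of columns meeting the row `0` part of
`α` span `Rⁿ` modulo the columns. -/
theorem homogeneousVectors_le_sup {s : Fin M → K} (hs : Function.Injective s) (q : ℕ) :
    homogeneousVectors K n M q ≤ (columnSpan K n M M).restrictScalars K ⊔
      Submodule.span K ((fun x : Fin n × (Fin n × Fin M →₀ ℕ) =>
        (Pi.single x.1 (shiftedMonomial s x.2) : Fin n → MvPolynomial (Fin n × Fin M) K)) ''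
          {x | x.2.degree = q ∧ #(topSupport M x.2) ≤ (x.1 : ℕ)}) := by
  set U : ℕ → Submodule K (Fin n → MvPolynomial (Fin n × Fin M) K) := fun q =>
    (columnSpan K n M M).restrictScalars K ⊔
      Submodule.span K ((fun x : Fin n × (Fin n × Fin M →₀ ℕ) =>
        (Pi.single x.1 (shiftedMonomial s x.2) : Fin n → MvPolynomial (Fin n × Fin M) K)) ''
          {x | x.2.degree = q ∧ #(topSupport M x.2) ≤ (x.1 : ℕ)}) with hU
  have smul_mem : ∀ q (p : Fin n × Fin M), p.1 ≠ 0 → ∀ v ∈ U q, shiftedVar s p • v ∈ U (q + 1) := by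
    intro q p hp v hv
    obtain ⟨a, ha, b, hb, rfl⟩ := Submodule.mem_sup.1 hv
    rw [smul_add]
    refine add_mem (Submodule.mem_sup_left ?_) (Submodule.mem_sup_right ?_)
    · exact Submodule.smul_mem (columnSpan K n M M) _ ha
    · clear hv
      induction hb using Submodule.span_induction with
      | mem f hf =>
        obtain ⟨⟨i, α⟩, ⟨h1, h2⟩, rfl⟩ := hf
        refine Submodule.subset_span ⟨(i, α + Finsupp.single p 1), ⟨?_, ?_⟩, ?_⟩
        · simpa using h1
        · simpa [topSupport_add_single _ _ hp] using h2
        · simp only [shiftedMonomial_add, shiftedMonomial_single]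
          rw [← Pi.single_smul, smul_eq_mul, mul_comm]
      | zero => simp
      | add f g _ _ hf hg => rw [smul_add]; exact add_mem hf hg
      | smul a f _ hf => rw [smul_comm]; exact Submodule.smul_mem _ _ hf
  change homogeneousVectors K n M q ≤ U q
  induction q with
  | zero =>
    refine homogeneousVectors_le (homogeneousSubmodule_le_span_shiftedMonomial s 0) ?_
    rintro i _ ⟨α, hα, rfl⟩
    refine Submodule.mem_sup_right (Submodule.subset_span ⟨(i, α), ⟨hα, ?_⟩, rfl⟩)
    have : α = 0 := (Finsupp.degree_eq_zero_iff _).1 hα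
    simp [this, topSupport]
  | succ q ih =>
    refine homogeneousVectors_le (homogeneousSubmodule_le_span_shiftedMonomial s _) ?_
    rintro i _ ⟨α, hα, rfl⟩
    by_cases hi : #(topSupport M α) ≤ (i : ℕ)
    · exact Submodule.mem_sup_right (Submodule.subset_span ⟨(i, α), ⟨hα, hi⟩, rfl⟩)
    rw [not_le] at hi
    have hcol : ∀ j ∈ topSupport M α,
        (fun i' : Fin n => shiftedMonomial s α * C (s j ^ (i' : ℕ))) ∈ U (q + 1) := by
      intro j hj
      have hj0 : α (0, j) ≠ 0 := (mem_filter.1 hj).2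
      obtain ⟨β, rfl⟩ : ∃ β, α = β + Finsupp.single (0, j) 1 := ⟨α - Finsupp.single (0, j) 1,
        (tsub_add_cancel_of_le (Finsupp.single_le_iff.2 (Nat.one_le_iff_ne_zero.2 hj0))).symm⟩
      have hβ : β.degree = q := by
        have : (β + Finsupp.single (0, j) 1).degree = q + 1 := hα
        simpa using this
      have heq : (fun i' : Fin n => shiftedMonomial s (β + Finsupp.single (0, j) 1) *
          C (s j ^ (i' : ℕ))) = shiftedMonomial s β • (genMatrix K n M).col j -
            ∑ i' ∈ univ.erase (0 : Fin n),
              shiftedVar s (i', j) • Pi.single i' (shiftedMonomial s β) := by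
        ext1 i'
        rw [shiftedMonomial_add, shiftedMonomial_single, shiftedVar_zero, Pi.sub_apply,
          Finset.sum_apply]
        simp only [Pi.smul_apply, smul_eq_mul, Pi.single_apply, mul_ite, mul_zero]
        rw [sum_ite_eq]
        simp only [genMatrix, Matrix.col_apply, Matrix.of_apply, mem_erase, mem_univ, and_true]
        by_cases h : i' = 0
        · simp [h]
        · rw [X_eq_shiftedVar_add s h, if_pos h]
          ring
      rw [heq]
      refine sub_mem (Submodule.mem_sup_left ?_) (Submodule.sum_mem _ fun i' hi' => ?_)
      · exact Submodule.smul_mem (columnSpan K n M M) _ (col_mem_columnSpan j.2)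
      · refine smul_mem _ _ (ne_of_mem_erase hi') _ (ih fun i'' _ => ?_)
        rw [Pi.single_apply]
        split_ifs
        · exact hβ ▸ shiftedMonomial_mem s β
        · exact zero_mem _
    obtain ⟨S, hS, hScard⟩ := exists_subset_card_eq (s := topSupport M α)
      (min_le_left #(topSupport M α) n)
    obtain ⟨c, hc⟩ := exists_vandermonde_combination hs S (i := i) (by omega)
    have heq : (Pi.single i (shiftedMonomial s α) : Fin n → MvPolynomial (Fin n × Fin M) K) =
        ∑ j ∈ S, c j • (fun i' : Fin n => shiftedMonomial s α * C (s j ^ (i' : ℕ))) -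
          ∑ i' ∈ ({i' | #S ≤ (i' : ℕ)} : Finset (Fin n)),
            (∑ j ∈ S, c j * s j ^ (i' : ℕ)) • Pi.single i' (shiftedMonomial s α) := by
      ext1 i'
      rw [Pi.sub_apply, Finset.sum_apply, Finset.sum_apply]
      simp only [Pi.smul_apply, Pi.single_apply, smul_ite, smul_zero]
      rw [sum_ite_eq]
      have h1 : ∑ j ∈ S, c j • (shiftedMonomial s α * C (s j ^ (i' : ℕ))) =
          (∑ j ∈ S, c j * s j ^ (i' : ℕ)) • shiftedMonomial s α := by
        rw [sum_smul]
        refine sum_congr rfl fun j _ => ?_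
        rw [mul_comm (shiftedMonomial s α), ← smul_eq_C_mul, smul_smul]
      rw [h1]
      simp only [mem_filter, mem_univ, true_and]
      by_cases h : #S ≤ (i' : ℕ)
      · have : i' ≠ i := by rintro rfl; omega
        simp [h, this]
      · rw [if_neg h, hc _ (not_le.1 h)]
        simp [Fin.ext_iff]
    rw [heq]
    refine sub_mem (Submodule.sum_mem _ fun j hj => Submodule.smul_mem _ _ (hcol j (hS hj)))
      (Submodule.sum_mem _ fun i' hi' => Submodule.smul_mem _ _ (Submodule.mem_sup_right
        (Submodule.subset_span ⟨(i', α), ⟨hα, ?_⟩, rfl⟩)))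
    have := (mem_filter.1 hi').2
    have := i'.2
    dsimp only
    omega

/-- The specialization `x_{ij} ↦ s_j ^ i x_{0j}`. -/
noncomputable def vandermondeSpecialization (s : Fin M → K) :
    MvPolynomial (Fin n × Fin M) K →ₐ[K] MvPolynomial (Fin n × Fin M) K :=
  aeval fun p => C (s p.2 ^ (p.1 : ℕ)) * X (0, p.2)

lemma vandermondeSpecialization_shiftedVar (s : Fin M → K) (p : Fin n × Fin M) :
    vandermondeSpecialization s (shiftedVar s p) = if p.1 = 0 then shiftedVar s p else 0 := by
  obtain ⟨i, j⟩ := p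
  by_cases hi : i = 0
  · simp [vandermondeSpecialization, shiftedVar, hi]
  · simp [vandermondeSpecialization, shiftedVar, hi, algebraMap_eq]

lemma sub_vandermondeSpecialization_mem (s : Fin M → K) {q : ℕ}
    {f : MvPolynomial (Fin n × Fin M) K}
    (hf : f ∈ homogeneousSubmodule (Fin n × Fin M) K (q + 1)) :
    f - vandermondeSpecialization s f ∈ Submodule.span K
      {g | ∃ p : Fin n × Fin M, p.1 ≠ 0 ∧ ∃ r ∈ homogeneousSubmodule (Fin n × Fin M) K q,
        g = shiftedVar s p * r} := by
  have hf' := homogeneousSubmodule_le_span_shiftedMonomial s (q + 1) hf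
  clear hf
  induction hf' using Submodule.span_induction with
  | mem f hf =>
    obtain ⟨α, hα, rfl⟩ := hf
    by_cases h : ∃ p ∈ α.support, p.1 ≠ 0
    · obtain ⟨p, hp, hp0⟩ := h
      have hzero : vandermondeSpecialization s (shiftedMonomial s α) = 0 := by
        rw [shiftedMonomial, Finsupp.prod, map_prod]
        refine prod_eq_zero hp ?_
        rw [map_pow, vandermondeSpecialization_shiftedVar, if_neg hp0,
          zero_pow (Finsupp.mem_support_iff.1 hp)]
      obtain ⟨β, rfl⟩ : ∃ β, α = β + Finsupp.single p 1 := ⟨α - Finsupp.single p 1,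
        (tsub_add_cancel_of_le (Finsupp.single_le_iff.2
          (Nat.one_le_iff_ne_zero.2 (Finsupp.mem_support_iff.1 hp)))).symm⟩
      have hβ : β.degree = q := by
        have : (β + Finsupp.single p 1).degree = q + 1 := hα
        simpa using this
      rw [hzero, sub_zero]
      refine Submodule.subset_span ⟨p, hp0, _, hβ ▸ shiftedMonomial_mem s β, ?_⟩
      rw [shiftedMonomial_add, shiftedMonomial_single, mul_comm]
    · push Not at h
      have : vandermondeSpecialization s (shiftedMonomial s α) = shiftedMonomial s α := by
        rw [shiftedMonomial, Finsupp.prod, map_prod]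
        refine prod_congr rfl fun p hp => ?_
        rw [map_pow, vandermondeSpecialization_shiftedVar, if_pos (h p hp)]
      simp [this]
  | zero => simp
  | add f g _ _ hf hg => rw [map_add, add_sub_add_comm]; exact add_mem hf hg
  | smul a f _ hf => rw [map_smul, ← smul_sub]; exact Submodule.smul_mem _ _ hf

omit [NeZero n] in
lemma det_submatrix_mem_colon {m : ℕ} (e : Fin n → Fin M) (he : ∀ j, (e j : ℕ) < m) :
    ((genMatrix K n M).submatrix id e).det ∈ (columnSpan K n M m).colon Set.univ := by
  refine Submodule.mem_colon.2 fun v _ => ?_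
  generalize hA : (genMatrix K n M).submatrix id e = A
  have h : A.det • v = A.mulVec (A.adjugate.mulVec v) := by
    rw [Matrix.mulVec_mulVec, Matrix.mul_adjugate, Matrix.smul_mulVec, Matrix.one_mulVec]
  rw [h, Matrix.mulVec_eq_sum]
  refine Submodule.sum_mem _ fun j _ => ?_
  rw [op_smul_eq_smul]
  refine Submodule.smul_mem _ _ ?_
  rw [← hA]
  exact col_mem_columnSpan (he j)

omit [NeZero n] in
lemma det_submatrix_mem_homogeneousSubmodule (e : Fin n → Fin M) :
    ((genMatrix K n M).submatrix id e).det ∈ homogeneousSubmodule (Fin n × Fin M) K n := by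
  rw [Matrix.det_apply]
  refine Submodule.sum_mem _ fun σ _ => ?_
  rw [Units.smul_def]
  refine zsmul_mem ?_ _
  have h : ∀ i ∈ (univ : Finset (Fin n)),
      ((genMatrix K n M).submatrix id e (σ i) i).IsHomogeneous 1 :=
    fun i _ => isHomogeneous_X K _
  simpa using IsHomogeneous.prod _ _ _ h

lemma vandermondeSpecialization_det (s : Fin M → K) (e : Fin n → Fin M) :
    vandermondeSpecialization s ((genMatrix K n M).submatrix id e).det =
      (Matrix.vandermonde (s ∘ e)).det • ∏ j, X (0, e j) := by
  rw [AlgHom.map_det, ← Matrix.det_transpose (Matrix.vandermonde _), smul_eq_C_mul,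
    RingHom.map_det, mul_comm, ← Matrix.det_mul_row]
  congr 1
  ext1 i j
  simp [vandermondeSpecialization, genMatrix, Matrix.vandermonde, mul_comm]

/-- The monomials `w^α` in which fewer than `n` of the variables of row `0` and the first `m`
columns occur span `R` modulo the annihilator of the cokernel of the first `m` columns. -/
theorem homogeneousSubmodule_le_sup {s : Fin M → K} (hs : Function.Injective s) (m q : ℕ) :
    homogeneousSubmodule (Fin n × Fin M) K q ≤
      ((columnSpan K n M m).colon Set.univ).restrictScalars K ⊔
        Submodule.span K (shiftedMonomial s '' {α | α.degree = q ∧ #(topSupport m α) < n}) := by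
  set U : ℕ → Submodule K (MvPolynomial (Fin n × Fin M) K) := fun q =>
    ((columnSpan K n M m).colon Set.univ).restrictScalars K ⊔
      Submodule.span K (shiftedMonomial s '' {α | α.degree = q ∧ #(topSupport m α) < n}) with hU
  have mul_mem : ∀ q (p : Fin n × Fin M), p.1 ≠ 0 → ∀ v ∈ U q, shiftedVar s p * v ∈ U (q + 1) := by
    intro q p hp v hv
    obtain ⟨a, ha, b, hb, rfl⟩ := Submodule.mem_sup.1 hv
    rw [mul_add]
    refine add_mem (Submodule.mem_sup_left ?_) (Submodule.mem_sup_right ?_)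
    · exact Ideal.mul_mem_left ((columnSpan K n M m).colon Set.univ) _ ha
    · clear hv
      induction hb using Submodule.span_induction with
      | mem f hf =>
        obtain ⟨α, ⟨h1, h2⟩, rfl⟩ := hf
        refine Submodule.subset_span ⟨α + Finsupp.single p 1, ⟨?_, ?_⟩, ?_⟩
        · simpa using h1
        · simpa [topSupport_add_single _ _ hp] using h2
        · rw [shiftedMonomial_add, shiftedMonomial_single, mul_comm]
      | zero => simp
      | add f g _ _ hf hg => rw [mul_add]; exact add_mem hf hg
      | smul a f _ hf => rw [mul_smul_comm]; exact Submodule.smul_mem _ _ hf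
  change _ ≤ U q
  induction q with
  | zero =>
    refine (homogeneousSubmodule_le_span_shiftedMonomial s 0).trans (Submodule.span_le.2 ?_)
    rintro _ ⟨α, hα, rfl⟩
    refine Submodule.mem_sup_right (Submodule.subset_span ⟨α, ⟨hα, ?_⟩, rfl⟩)
    have : α = 0 := (Finsupp.degree_eq_zero_iff _).1 hα
    simpa [this, topSupport] using Nat.pos_of_neZero n
  | succ q ih =>
    refine (homogeneousSubmodule_le_span_shiftedMonomial s _).trans (Submodule.span_le.2 ?_)
    rintro _ ⟨α, hα, rfl⟩
    by_cases hi : #(topSupport m α) < n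
    · exact Submodule.mem_sup_right (Submodule.subset_span ⟨α, ⟨hα, hi⟩, rfl⟩)
    obtain ⟨S, hS, hScard⟩ := exists_subset_card_eq (not_lt.1 hi)
    let e := S.orderEmbOfFin hScard
    have he : ∀ j, (e j : ℕ) < m ∧ α (0, e j) ≠ 0 := fun j => by
      simpa [topSupport] using hS (S.orderEmbOfFin_mem hScard j)
    let γ : Fin n × Fin M →₀ ℕ := ∑ j, Finsupp.single (0, e j) 1
    have hγ : γ ≤ α := by
      rintro ⟨i, j⟩
      simp only [γ, Finsupp.finsetSum_apply, Finsupp.single_apply, Prod.mk.injEq]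
      by_cases h : i = 0 ∧ ∃ j', e j' = j
      · obtain ⟨rfl, j', rfl⟩ := h
        simpa using Nat.one_le_iff_ne_zero.2 (he j').2
      · rw [sum_eq_zero fun j' _ => if_neg fun h' => h ⟨h'.1.symm, j', h'.2⟩]
        exact Nat.zero_le _
    obtain ⟨β, rfl⟩ := exists_add_of_le hγ
    have hγdeg : γ.degree = n := by simp [γ]
    have hγmon : shiftedMonomial s γ = ∏ j, X (0, e j) := by
      simp only [γ, ← shiftedVar_zero s, ← shiftedMonomial_single]
      have (T : Finset (Fin n)) : shiftedMonomial s (∑ j ∈ T, Finsupp.single ((0 : Fin n), e j) 1) =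
          ∏ j ∈ T, shiftedMonomial s (Finsupp.single (0, e j) 1) := by
        induction T using Finset.cons_induction with
        | empty => simp [shiftedMonomial]
        | cons a T ha ih => rw [sum_cons, prod_cons, shiftedMonomial_add, ih]
      exact this univ
    obtain ⟨d, hd⟩ := Nat.exists_eq_succ_of_ne_zero (NeZero.ne n)
    have hq : d + β.degree = q := by
      have : (γ + β).degree = q + 1 := hα
      rw [map_add, hγdeg] at this
      omega
    have hdet : (Matrix.vandermonde (s ∘ e)).det ≠ 0 :=
      Matrix.det_vandermonde_ne_zero_iff.2 (hs.comp e.injective)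
    have hY := sub_vandermondeSpecialization_mem s (q := d)
      (f := ((genMatrix K n M).submatrix id e).det)
      (by simpa [hd] using det_submatrix_mem_homogeneousSubmodule (K := K) e)
    rw [vandermondeSpecialization_det, ← hγmon] at hY
    have hYU : ∀ y ∈ Submodule.span K
        {g | ∃ p : Fin n × Fin M, p.1 ≠ 0 ∧ ∃ r ∈ homogeneousSubmodule (Fin n × Fin M) K d,
          g = shiftedVar s p * r}, y * shiftedMonomial s β ∈ U (q + 1) := by
      intro y hy
      induction hy using Submodule.span_induction with
      | mem f hf =>
        obtain ⟨p, hp, r, hr, rfl⟩ := hf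
        rw [mul_assoc]
        refine mul_mem q p hp _ (ih ?_)
        rw [← hq]
        exact IsHomogeneous.mul hr (shiftedMonomial_mem s β)
      | zero => simp
      | add f g _ _ hf hg => rw [add_mul]; exact add_mem hf hg
      | smul a f _ hf => rw [smul_mul_assoc]; exact Submodule.smul_mem _ _ hf
    refine (Submodule.smul_mem_iff _ hdet).1 ?_
    have heq : (Matrix.vandermonde (s ∘ e)).det • shiftedMonomial s (γ + β) =
        shiftedMonomial s β * ((genMatrix K n M).submatrix id e).det -
        (((genMatrix K n M).submatrix id e).det -
          (Matrix.vandermonde (s ∘ e)).det • shiftedMonomial s γ) * shiftedMonomial s β := by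
      rw [shiftedMonomial_add, smul_eq_C_mul, smul_eq_C_mul]
      ring
    rw [heq]
    exact sub_mem (Submodule.mem_sup_left (Ideal.mul_mem_left
      ((columnSpan K n M m).colon Set.univ) _ (det_submatrix_mem_colon e fun j => (he j).1)))
      (hYU _ hY)

omit [NeZero n] in
lemma mem_finsuppAntidiag_univ {σ : Type*} [Fintype σ] [DecidableEq σ] {q : ℕ} {α : σ →₀ ℕ} :
    α ∈ (univ : Finset σ).finsuppAntidiag q ↔ α.degree = q := by
  simp [mem_finsuppAntidiag, Finsupp.degree_eq_sum]

omit [NeZero n] in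
lemma finrank_span_image_le {V ι : Type*} [AddCommGroup V] [Module K V] (f : ι → V)
    (S : Finset ι) : Module.finrank K (Submodule.span K (f '' S)) ≤ #S := by
  classical
  rw [← coe_image]
  exact (finrank_span_finset_le_card _).trans card_image_le

omit [NeZero n] in
instance {V ι : Type*} [AddCommGroup V] [Module K V] (f : ι → V) (S : Finset ι) :
    Module.Finite K (Submodule.span K (f '' S)) :=
  Module.Finite.span_of_finite K (S.finite_toSet.image f)

lemma homogeneousVectors_le_span (q : ℕ) : homogeneousVectors K n M q ≤
    Submodule.span K ((fun x : Fin n × (Fin n × Fin M →₀ ℕ) =>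
      (Pi.single x.1 (shiftedMonomial (fun _ => 0) x.2) :
        Fin n → MvPolynomial (Fin n × Fin M) K)) ''
          ((univ : Finset (Fin n)) ×ˢ univ.finsuppAntidiag q :
            Finset (Fin n × (Fin n × Fin M →₀ ℕ)))) := by
  refine homogeneousVectors_le (homogeneousSubmodule_le_span_shiftedMonomial (fun _ => 0) q) ?_
  rintro i _ ⟨α, hα, rfl⟩
  exact Submodule.subset_span ⟨(i, α), by simpa [Finsupp.degree_eq_sum] using hα, rfl⟩

instance (q : ℕ) : Module.Finite K (homogeneousVectors K n M q) :=
  Submodule.finiteDimensional_of_le (homogeneousVectors_le_span q)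

lemma card_columns_lt {m : ℕ} (hm : m ≤ M) : #({j | (j : ℕ) < m} : Finset (Fin M)) = m := by
  rw [Fin.card_filter_val_lt, min_eq_right hm]

omit [NeZero n] in
lemma sum_choose_range_eq (u : PowerSeries ℤ) (m : ℕ) {φ : ℕ → ℤ} (hφ : ∀ i, n ≤ i → φ i = 0) :
    ∑ i ∈ range (m + 1), ((m.choose i : PowerSeries ℤ) * (φ i : PowerSeries ℤ)) * u ^ i =
      ∑ i ∈ range n, ((m.choose i : PowerSeries ℤ) * (φ i : PowerSeries ℤ)) * u ^ i := by
  rw [sum_subset (range_subset_range.2 (le_max_left (m + 1) n)), eq_comm,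
    sum_subset (range_subset_range.2 (le_max_right (m + 1) n))]
  · intro i _ hi
    simp [hφ i (not_lt.1 fun h => hi (mem_range.2 h))]
  · intro i _ hi
    simp [Nat.choose_eq_zero_of_lt (Nat.lt_of_succ_le (not_lt.1 fun h => hi (mem_range.2 h)))]

lemma finrank_genCokerComp_le {s : Fin M → K} (hs : Function.Injective s) (q : ℕ) :
    (Module.finrank K (genCokerComp K n M q) : ℤ) ≤
      PowerSeries.coeff q ((∑ i ∈ range n, ((M.choose i * (n - i) : ℕ) : PowerSeries ℤ) *
        (PowerSeries.X * geomSeries) ^ i) * geomSeries ^ (n * M - M)) := by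
  let S : Finset (Fin n × (Fin n × Fin M →₀ ℕ)) :=
    {x ∈ univ ×ˢ univ.finsuppAntidiag q | #(topSupport M x.2) ≤ (x.1 : ℕ)}
  let f : Fin n × (Fin n × Fin M →₀ ℕ) → Fin n → MvPolynomial (Fin n × Fin M) K :=
    fun x => Pi.single x.1 (shiftedMonomial s x.2)
  let π : (Fin n → MvPolynomial (Fin n × Fin M) K) →ₗ[K] genCoker K n M :=
    LinearMap.restrictScalars K
      (Submodule.mkQ (LinearMap.range (Matrix.mulVecLin (genMatrix K n M))))
  have hle : genCokerComp K n M q ≤ Submodule.span K ((π ∘ f) '' S) := by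
    refine (Submodule.map_mono (homogeneousVectors_le_sup hs q)).trans ?_
    rw [Submodule.map_sup, Set.image_comp, ← Submodule.map_span]
    refine sup_le ?_ (Submodule.map_mono (Submodule.span_mono (Set.image_mono ?_)))
    · rintro _ ⟨v, hv, rfl⟩
      have hv' : v ∈ columnSpan K n M M := hv
      rw [columnSpan_self] at hv'
      have : Submodule.mkQ (LinearMap.range (Matrix.mulVecLin (genMatrix K n M))) v = 0 :=
        (Submodule.Quotient.mk_eq_zero _).2 hv'
      rw [LinearMap.restrictScalars_apply, this]
      exact zero_mem _
    · rintro ⟨i, α⟩ ⟨h1, h2⟩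
      exact mem_coe.2 (mem_filter.2 ⟨mem_product.2
        ⟨mem_univ _, mem_finsuppAntidiag_univ.2 h1⟩, h2⟩)
  have hcard : #S = ∑ α ∈ (univ : Finset (Fin n × Fin M)).finsuppAntidiag q,
      (n - #(topSupport M α)) := by
    rw [card_filter, sum_product_right]
    refine sum_congr rfl fun α _ => ?_
    rw [← card_filter]
    have := card_filter_add_card_filter_not (s := (univ : Finset (Fin n)))
      (fun i => #(topSupport M α) ≤ (i : ℕ))
    simp only [not_le, Fin.card_filter_val_lt, card_univ, Fintype.card_fin] at this
    dsimp only
    omega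
  have hcount := sum_weight_finsuppAntidiag (n := n) ({j | (j : ℕ) < M} : Finset (Fin M))
    (fun c => ((n - c : ℕ) : ℤ)) q
  rw [card_columns_lt le_rfl] at hcount
  have hsum : ∑ i ∈ range n, ((M.choose i * (n - i) : ℕ) : PowerSeries ℤ) *
      (PowerSeries.X * geomSeries) ^ i = ∑ i ∈ range (M + 1), ((M.choose i : PowerSeries ℤ) *
      (((n - i : ℕ) : ℤ) : PowerSeries ℤ)) * (PowerSeries.X * geomSeries) ^ i := by
    rw [sum_choose_range_eq (n := n) _ M fun i hi => by simp [Nat.sub_eq_zero_of_le hi]]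
    simp
  rw [hsum, ← hcount]
  calc (Module.finrank K (genCokerComp K n M q) : ℤ)
      ≤ (#S : ℤ) := by
        exact_mod_cast (Submodule.finrank_mono hle).trans (finrank_span_image_le _ S)
    _ = _ := by rw [hcard]; push_cast; rfl

omit [NeZero n] in
lemma homogeneousComponent_succ_mul_X {σ R : Type*} [CommSemiring R] (q : ℕ)
    (f : MvPolynomial σ R) (i : σ) :
    homogeneousComponent (q + 1) (f * X i) = homogeneousComponent q f * X i := by
  classical
  ext d
  rw [coeff_homogeneousComponent, coeff_mul_X', coeff_mul_X', coeff_homogeneousComponent]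
  split_ifs with h1 h2 h3 h2 h3 <;> try rfl
  · exfalso
    apply h3
    have := tsub_add_cancel_of_le (Finsupp.single_le_iff.2 (Nat.one_le_iff_ne_zero.2
      (Finsupp.mem_support_iff.1 h2)))
    rw [← this, map_add, Finsupp.degree_single] at h1
    omega
  · exfalso
    apply h1
    have := tsub_add_cancel_of_le (Finsupp.single_le_iff.2 (Nat.one_le_iff_ne_zero.2
      (Finsupp.mem_support_iff.1 h2)))
    rw [← this, map_add, Finsupp.degree_single, h3]

omit [NeZero n] in
lemma homogeneousComponent_zero_mul_X {σ R : Type*} [CommSemiring R]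
    (f : MvPolynomial σ R) (i : σ) : homogeneousComponent 0 (f * X i) = 0 := by
  classical
  simp [homogeneousComponent_zero, coeff_mul_X']

/-- The degree-`q` component of a vector of polynomials. -/
noncomputable def vectorComponent (K : Type) [Field K] (n M q : ℕ) :
    (Fin n → MvPolynomial (Fin n × Fin M) K) →ₗ[K] (Fin n → MvPolynomial (Fin n × Fin M) K) :=
  (homogeneousComponent q).compLeft (Fin n)

omit [NeZero n] in
lemma vectorComponent_mem (q : ℕ) (v : Fin n → MvPolynomial (Fin n × Fin M) K) :
    vectorComponent K n M q v ∈ homogeneousVectors K n M q :=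
  fun i _ => homogeneousComponent_isHomogeneous q (v i)

omit [NeZero n] in
lemma vectorComponent_of_mem {q : ℕ} {v : Fin n → MvPolynomial (Fin n × Fin M) K}
    (hv : v ∈ homogeneousVectors K n M q) : vectorComponent K n M q v = v := by
  ext1 i
  change homogeneousComponent q (v i) = v i
  rw [homogeneousComponent_of_mem (hv i trivial), if_pos rfl]

omit [NeZero n] in
lemma vectorComponent_succ_smul_col (q : ℕ) (f : MvPolynomial (Fin n × Fin M) K) (j : Fin M) :
    vectorComponent K n M (q + 1) (f • (genMatrix K n M).col j) =
      homogeneousComponent q f • (genMatrix K n M).col j := by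
  ext1 i
  exact homogeneousComponent_succ_mul_X q f (i, j)

omit [NeZero n] in
lemma vectorComponent_zero_smul_col (f : MvPolynomial (Fin n × Fin M) K) (j : Fin M) :
    vectorComponent K n M 0 (f • (genMatrix K n M).col j) = 0 := by
  ext1 i
  exact homogeneousComponent_zero_mul_X f (i, j)

omit [NeZero n] in
lemma vectorComponent_mem_columnSpan {m : ℕ} (q : ℕ)
    {v : Fin n → MvPolynomial (Fin n × Fin M) K} (hv : v ∈ columnSpan K n M m) :
    vectorComponent K n M q v ∈ columnSpan K n M m := by
  obtain ⟨c, hc, rfl⟩ := Submodule.mem_span_set.1 hv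
  rw [Finsupp.sum, map_sum]
  refine Submodule.sum_mem _ fun x hx => ?_
  obtain ⟨j, hj, rfl⟩ := hc hx
  cases q with
  | zero => rw [vectorComponent_zero_smul_col]; exact zero_mem _
  | succ q =>
    rw [vectorComponent_succ_smul_col]
    exact Submodule.smul_mem _ _ (col_mem_columnSpan hj)

omit [NeZero n] in
lemma columnSpan_succ {m : ℕ} (hm : m < M) :
    columnSpan K n M (m + 1) =
      columnSpan K n M m ⊔ Submodule.span _ {(genMatrix K n M).col ⟨m, hm⟩} := by
  rw [columnSpan, columnSpan, ← Submodule.span_union, ← Set.image_singleton, ← Set.image_union]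
  congr 2
  ext j
  simp [Fin.ext_iff, le_iff_eq_or_lt]

omit [NeZero n] in
lemma columnSpan_inf_homogeneousVectors_zero (m : ℕ) :
    (columnSpan K n M m).restrictScalars K ⊓ homogeneousVectors K n M 0 = ⊥ := by
  refine (Submodule.eq_bot_iff _).2 fun v hv => ?_
  rw [← vectorComponent_of_mem hv.2]
  obtain ⟨c, hc, rfl⟩ := Submodule.mem_span_set.1 (show v ∈ columnSpan K n M m from hv.1)
  rw [Finsupp.sum, map_sum]
  refine sum_eq_zero fun x hx => ?_
  obtain ⟨j, hj, rfl⟩ := hc hx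
  exact vectorComponent_zero_smul_col _ _

lemma columnSpan_succ_inf_homogeneousVectors_le {s : Fin M → K} (hs : Function.Injective s)
    {m : ℕ} (hm : m < M) (q : ℕ) :
    (columnSpan K n M (m + 1)).restrictScalars K ⊓ homogeneousVectors K n M (q + 1) ≤
      ((columnSpan K n M m).restrictScalars K ⊓ homogeneousVectors K n M (q + 1)) ⊔
        Submodule.span K ((fun α : Fin n × Fin M →₀ ℕ =>
          shiftedMonomial s α • (genMatrix K n M).col ⟨m, hm⟩) ''
            {α : Fin n × Fin M →₀ ℕ | α.degree = q ∧ #(topSupport m α) < n}) := by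
  rintro v ⟨hv, hvq⟩
  have hv' : v ∈ columnSpan K n M (m + 1) := hv
  rw [columnSpan_succ hm] at hv'
  obtain ⟨a, ha, b, hb, rfl⟩ := Submodule.mem_sup.1 hv'
  obtain ⟨r, rfl⟩ := Submodule.mem_span_singleton.1 hb
  rw [← vectorComponent_of_mem hvq, map_add, vectorComponent_succ_smul_col]
  refine add_mem (Submodule.mem_sup_left
    ⟨vectorComponent_mem_columnSpan _ ha, vectorComponent_mem _ _⟩) ?_
  obtain ⟨x, hx, y, hy, hxy⟩ := Submodule.mem_sup.1
    (homogeneousSubmodule_le_sup (n := n) hs m q (homogeneousComponent_mem q r))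
  have hyq : y ∈ homogeneousSubmodule (Fin n × Fin M) K q := by
    refine Submodule.span_le.2 ?_ hy
    rintro _ ⟨α, hα, rfl⟩
    exact hα.1 ▸ shiftedMonomial_mem s α
  have hxq : x ∈ homogeneousSubmodule (Fin n × Fin M) K q := by
    rw [eq_sub_of_add_eq hxy]
    exact sub_mem (homogeneousComponent_mem q r) hyq
  rw [← hxy, add_smul]
  refine add_mem (Submodule.mem_sup_left ⟨Submodule.mem_colon.1 hx _ trivial, fun i _ => ?_⟩)
    (Submodule.mem_sup_right ?_)
  · exact IsHomogeneous.mul hxq (isHomogeneous_X K (i, (⟨m, hm⟩ : Fin M)))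
  · clear hxy hyq
    induction hy using Submodule.span_induction with
    | mem f hf =>
      obtain ⟨α, hα, rfl⟩ := hf
      exact Submodule.subset_span ⟨α, hα, rfl⟩
    | zero => simp
    | add f g _ _ hf hg => rw [add_smul]; exact add_mem hf hg
    | smul a f _ hf => rw [smul_assoc]; exact Submodule.smul_mem _ _ hf

lemma card_topSupport_lt {m : ℕ} (hm : m ≤ M) (q : ℕ) :
    (#{α ∈ (univ : Finset (Fin n × Fin M)).finsuppAntidiag q | #(topSupport m α) < n} : ℤ) =
      PowerSeries.coeff q ((∑ i ∈ range n, (m.choose i : PowerSeries ℤ) *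
        (PowerSeries.X * geomSeries) ^ i) * geomSeries ^ (n * M - m)) := by
  have hcount := sum_weight_finsuppAntidiag (n := n) ({j | (j : ℕ) < m} : Finset (Fin M))
    (fun c => if c < n then 1 else 0) q
  rw [card_columns_lt hm] at hcount
  have hsum : ∑ i ∈ range n, (m.choose i : PowerSeries ℤ) * (PowerSeries.X * geomSeries) ^ i =
      ∑ i ∈ range (m + 1), ((m.choose i : PowerSeries ℤ) *
        ((if i < n then 1 else 0 : ℤ) : PowerSeries ℤ)) * (PowerSeries.X * geomSeries) ^ i := by
    rw [sum_choose_range_eq (n := n) _ m fun i hi => if_neg (not_lt.2 hi)]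
    exact sum_congr rfl fun i hi => by simp [mem_range.1 hi]
  rw [hsum, ← hcount, card_filter]
  push_cast
  rfl

theorem finrank_columnSpan_inf_le {s : Fin M → K} (hs : Function.Injective s)
    {m : ℕ} (hm : m ≤ M) (q : ℕ) :
    (Module.finrank K ↥((columnSpan K n M m).restrictScalars K ⊓ homogeneousVectors K n M q) : ℤ) ≤
      PowerSeries.coeff q (PowerSeries.X * ∑ r ∈ range m, (∑ i ∈ range n,
        (r.choose i : PowerSeries ℤ) * (PowerSeries.X * geomSeries) ^ i) *
          geomSeries ^ (n * M - r)) := by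
  cases q with
  | zero => simp [columnSpan_inf_homogeneousVectors_zero]
  | succ q =>
    rw [PowerSeries.coeff_succ_X_mul, map_sum]
    induction m with
    | zero =>
      have : (columnSpan K n M 0).restrictScalars K ⊓ homogeneousVectors K n M (q + 1) = ⊥ := by
        simp [columnSpan]
      simp [this]
    | succ m ih =>
      rw [sum_range_succ, ← card_topSupport_lt (by omega)]
      have h := columnSpan_succ_inf_homogeneousVectors_le (n := n) hs (Nat.lt_of_succ_le hm) q
      have hset : {α : Fin n × Fin M →₀ ℕ | α.degree = q ∧ #(topSupport m α) < n} =
          ↑({α ∈ (univ : Finset (Fin n × Fin M)).finsuppAntidiag q |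
            #(topSupport m α) < n} : Finset _) := by
        ext α
        simp [Finsupp.degree_eq_sum]
      rw [hset] at h
      have := (Submodule.finrank_mono h).trans ((Submodule.finrank_add_le_finrank_add_finrank _ _).trans
        (Nat.add_le_add_left (finrank_span_image_le _ _) _))
      have := ih (by omega)
      zify at *
      linarith

lemma finrank_homogeneousVectors (q : ℕ) :
    Module.finrank K (homogeneousVectors K n M q) =
      n * #((univ : Finset (Fin n × Fin M)).finsuppAntidiag q) := by
  refine le_antisymm ?_ ?_
  · refine (Submodule.finrank_mono (homogeneousVectors_le_span q)).trans
      ((finrank_span_image_le _ _).trans_eq ?_)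
    rw [card_product, card_univ, Fintype.card_fin]
  let b := Pi.basis fun _ : Fin n => basisMonomials (Fin n × Fin M) K
  let ι := Fin n × {α // α ∈ (univ : Finset (Fin n × Fin M)).finsuppAntidiag q}
  have hli : LinearIndependent K fun x : ι => b ⟨x.1, x.2.1⟩ := by
    refine b.linearIndependent.comp (fun x : ι => (⟨x.1, x.2.1⟩ : Σ _ : Fin n, _)) ?_
    rintro ⟨i, α, _⟩ ⟨i', α', _⟩ h
    obtain ⟨rfl, rfl⟩ : i = i' ∧ α = α' := by simpa using h
    rfl
  have hmem (x : ι) : b ⟨x.1, x.2.1⟩ ∈ homogeneousVectors K n M q := by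
    intro i _
    simp only [b, Pi.basis_apply, coe_basisMonomials, Pi.single_apply]
    split_ifs
    · exact isHomogeneous_monomial _ (mem_finsuppAntidiag_univ.1 x.2.2)
    · exact zero_mem _
  have hli' : LinearIndependent K
      fun x : ι => (⟨_, hmem x⟩ : homogeneousVectors K n M q) :=
    LinearIndependent.of_comp (Submodule.subtype _) hli
  simpa [ι] using hli'.fintype_card_le_finrank

lemma finrank_genCokerComp_add (q : ℕ) :
    Module.finrank K (genCokerComp K n M q) +
      Module.finrank K ↥((columnSpan K n M M).restrictScalars K ⊓ homogeneousVectors K n M q) =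
        Module.finrank K (homogeneousVectors K n M q) := by
  let π : (Fin n → MvPolynomial (Fin n × Fin M) K) →ₗ[K] genCoker K n M :=
    LinearMap.restrictScalars K
      (Submodule.mkQ (LinearMap.range (Matrix.mulVecLin (genMatrix K n M))))
  have h := LinearMap.finrank_range_add_finrank_ker (π.domRestrict (homogeneousVectors K n M q))
  rw [LinearMap.range_domRestrict] at h
  rw [← h]
  congr 1
  have hker : (LinearMap.ker (π.domRestrict (homogeneousVectors K n M q))).map
      (Submodule.subtype _) =
      (columnSpan K n M M).restrictScalars K ⊓ homogeneousVectors K n M q := by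
    ext v
    simp [π, columnSpan_self, and_comm]
  rw [← hker]
  exact (Submodule.equivMapOfInjective (homogeneousVectors K n M q).subtype
    (Submodule.subtype_injective _)
    (LinearMap.ker (π.domRestrict (homogeneousVectors K n M q)))).finrank_eq.symm

theorem finrank_genCokerComp_of_injective {s : Fin M → K} (hs : Function.Injective s) (q : ℕ) :
    (Module.finrank K (genCokerComp K n M q) : ℤ) =
      PowerSeries.coeff q ((∑ i ∈ range n, ((M.choose i * (n - i) : ℕ) : PowerSeries ℤ) *
        (PowerSeries.X * geomSeries) ^ i) * geomSeries ^ (n * M - M)) := by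
  refine (finrank_genCokerComp_le hs q).antisymm ?_
  have h1 := finrank_columnSpan_inf_le (n := n) hs le_rfl q
  have h2 := finrank_homogeneousVectors (K := K) (n := n) (M := M) q
  have h3 := finrank_genCokerComp_add (K := K) (n := n) (M := M) q
  have h4 := congrArg (PowerSeries.coeff q)
    (telescoping_identity n M M (Nat.pos_of_neZero n) le_rfl)
  have h5 := sum_weight_finsuppAntidiag (n := n) (∅ : Finset (Fin M)) (fun _ => 1) q
  simp only [sum_const, card_empty] at h5
  rw [map_add] at h4
  have h6 : PowerSeries.coeff q ((n : PowerSeries ℤ) * geomSeries ^ (n * M)) =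
      n * #((univ : Finset (Fin n × Fin M)).finsuppAntidiag q) := by
    rw [← map_natCast (PowerSeries.C (R := ℤ)), PowerSeries.coeff_C_mul]
    simp at h5 ⊢
    simp [h5]
  zify at h2 h3
  linarith

end Spanning

section BaseChange

open MvPolynomial Finset

variable {k K : Type} [Field k] [Field K] [Algebra k K] {n M : ℕ}

lemma finrank_le_of_le_span_image {W W' : Type*} [AddCommGroup W] [Module k W] [AddCommGroup W']
    [Module K W'] (φ : W →ₛₗ[algebraMap k K] W') (V : Submodule k W) [Module.Finite k V]
    {U : Submodule K W'} (h : U ≤ Submodule.span K (φ '' V)) :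
    Module.finrank K U ≤ Module.finrank k V := by
  let b := Module.finBasis k V
  have hU : U ≤ Submodule.span K (Set.range fun i => φ (b i)) := by
    refine h.trans (Submodule.span_le.2 ?_)
    rintro _ ⟨v, hv, rfl⟩
    have := congrArg (fun x : V => φ x) (b.sum_repr ⟨v, hv⟩)
    simp only [Submodule.coe_sum, Submodule.coe_smul, map_sum, LinearMap.map_smulₛₗ] at this
    rw [← this]
    exact Submodule.sum_mem _ fun i _ =>
      Submodule.smul_mem _ _ (Submodule.subset_span ⟨i, rfl⟩)
  have : Module.Finite K (Submodule.span K (Set.range fun i => φ (b i))) :=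
    Module.Finite.span_of_finite K (Set.finite_range _)
  simpa using (Submodule.finrank_mono hU).trans (finrank_range_le_card _)

lemma finrank_map_le_of_le_span_image {W W' Q Q' : Type*} [AddCommGroup W] [Module k W]
    [AddCommGroup W'] [Module K W'] [AddCommGroup Q] [Module k Q] [AddCommGroup Q'] [Module K Q']
    {π : W →ₗ[k] Q} {π' : W' →ₗ[K] Q'} (φ : W →ₛₗ[algebraMap k K] W')
    (hφ : ∀ v, π v = 0 → π' (φ v) = 0) (V : Submodule k W) [Module.Finite k V]
    {U : Submodule K W'} (h : U ≤ Submodule.span K (φ '' V)) :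
    Module.finrank K (U.map π') ≤ Module.finrank k (V.map π) := by
  let N := LinearMap.ker (π.domRestrict V)
  let ψ : (V ⧸ N) →ₛₗ[algebraMap k K] Q' :=
    N.liftQ ((π'.comp φ).comp V.subtype) fun v hv => hφ v hv
  have hU : U.map π' ≤ Submodule.span K (ψ '' (⊤ : Submodule k (V ⧸ N))) := by
    refine (Submodule.map_mono h).trans ?_
    rw [Submodule.map_span]
    refine Submodule.span_mono ?_
    rintro _ ⟨_, ⟨v, hv, rfl⟩, rfl⟩
    exact ⟨N.mkQ ⟨v, hv⟩, trivial, N.liftQ_apply _ _⟩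
  refine (finrank_le_of_le_span_image ψ ⊤ hU).trans_eq ?_
  rw [finrank_top, (π.domRestrict V).quotKerEquivRange.finrank_eq, LinearMap.range_domRestrict]

lemma homogeneousSubmodule_le_span_map (σ : Type*) (q : ℕ) :
    homogeneousSubmodule σ K q ≤
      Submodule.span K (map (algebraMap k K) '' (homogeneousSubmodule σ k q)) := by
  intro f hf
  rw [f.as_sum]
  refine Submodule.sum_mem _ fun d hd => ?_
  have : monomial d (coeff d f) = coeff d f • map (algebraMap k K) (monomial d 1) := by
    simp [smul_monomial]
  rw [this]
  refine Submodule.smul_mem _ _ (Submodule.subset_span ⟨_, ?_, rfl⟩)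
  exact isHomogeneous_monomial _ (by
    rw [Finsupp.degree_eq_weight_one]; exact hf (mem_support_iff.1 hd))

variable (k K n M) in
/-- Extension of scalars for vectors of polynomials. -/
noncomputable def extendVector :
    (Fin n → MvPolynomial (Fin n × Fin M) k) →ₛₗ[algebraMap k K]
      (Fin n → MvPolynomial (Fin n × Fin M) K) where
  toFun v i := map (algebraMap k K) (v i)
  map_add' v w := by ext1 i; simp
  map_smul' c v := by
    ext1 i
    simp only [Pi.smul_apply, smul_eq_C_mul, map_mul, map_C]

lemma extendVector_smul_col (g : MvPolynomial (Fin n × Fin M) k) (j : Fin M) :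
    extendVector k K n M (g • (genMatrix k n M).col j) =
      map (algebraMap k K) g • (genMatrix K n M).col j := by
  ext1 i
  simp [extendVector, genMatrix]

lemma extendVector_mem_columnSpan {m : ℕ} {v : Fin n → MvPolynomial (Fin n × Fin M) k}
    (hv : v ∈ columnSpan k n M m) : extendVector k K n M v ∈ columnSpan K n M m := by
  obtain ⟨c, hc, rfl⟩ := Submodule.mem_span_set.1 hv
  rw [Finsupp.sum, map_sum]
  refine Submodule.sum_mem _ fun x hx => ?_
  obtain ⟨j, hj, rfl⟩ := hc hx
  rw [extendVector_smul_col]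
  exact Submodule.smul_mem _ _ (col_mem_columnSpan hj)

lemma homogeneousVectors_le_span_extendVector (q : ℕ) :
    homogeneousVectors K n M q ≤
      Submodule.span K (extendVector k K n M '' homogeneousVectors k n M q) := by
  refine homogeneousVectors_le (homogeneousSubmodule_le_span_map (k := k) _ q) ?_
  rintro i _ ⟨g, hg, rfl⟩
  refine Submodule.subset_span ⟨Pi.single i g, fun j _ => ?_, ?_⟩
  · obtain rfl | h := eq_or_ne j i
    · simpa using hg
    · simp [h]
  · ext1 j
    obtain rfl | h := eq_or_ne j i <;> simp [extendVector, *]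

lemma columnSpan_inf_le_span_extendVector (m q : ℕ) :
    (columnSpan K n M m).restrictScalars K ⊓ homogeneousVectors K n M q ≤
      Submodule.span K (extendVector k K n M ''
        ↑((columnSpan k n M m).restrictScalars k ⊓ homogeneousVectors k n M q)) := by
  cases q with
  | zero => rw [columnSpan_inf_homogeneousVectors_zero]; exact bot_le
  | succ q =>
    rintro v ⟨hv, hvq⟩
    rw [← vectorComponent_of_mem hvq]
    obtain ⟨c, hc, rfl⟩ := Submodule.mem_span_set.1 (show v ∈ columnSpan K n M m from hv)
    rw [Finsupp.sum, map_sum]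
    refine Submodule.sum_mem _ fun x hx => ?_
    obtain ⟨j, hj, rfl⟩ := hc hx
    rw [vectorComponent_succ_smul_col]
    have := homogeneousSubmodule_le_span_map (k := k) _ q 
      (homogeneousComponent_mem q (c ((genMatrix K n M).col j)))
    generalize homogeneousComponent q (c ((genMatrix K n M).col j)) = r at this
    induction this using Submodule.span_induction with
    | mem f hf =>
      obtain ⟨g, hg, rfl⟩ := hf
      refine Submodule.subset_span ⟨g • (genMatrix k n M).col j,
        ⟨Submodule.smul_mem _ _ (col_mem_columnSpan hj), fun i _ => ?_⟩, extendVector_smul_col g j⟩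
      exact IsHomogeneous.mul hg (isHomogeneous_X k (i, j))
    | zero => simp
    | add f g _ _ hf hg => rw [add_smul]; exact add_mem hf hg
    | smul a f _ hf => rw [smul_assoc]; exact Submodule.smul_mem _ _ hf

lemma finrank_genCokerComp_le_of_algebra [NeZero n] (q : ℕ) :
    Module.finrank K (genCokerComp K n M q) ≤ Module.finrank k (genCokerComp k n M q) := by
  refine finrank_map_le_of_le_span_image (extendVector k K n M) (fun v hv => ?_) _
    (homogeneousVectors_le_span_extendVector q)
  have hv' : v ∈ columnSpan k n M M := by
    rw [columnSpan_self]; exact (Submodule.Quotient.mk_eq_zero _).1 hv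
  have := extendVector_mem_columnSpan (K := K) hv'
  rw [columnSpan_self] at this
  exact (Submodule.Quotient.mk_eq_zero _).2 this

theorem finrank_genCokerComp_eq_of_algebra [NeZero n] (q : ℕ) :
    Module.finrank k (genCokerComp k n M q) = Module.finrank K (genCokerComp K n M q) := by
  refine le_antisymm ?_ (finrank_genCokerComp_le_of_algebra q)
  have h1 := finrank_genCokerComp_add (K := K) (n := n) (M := M) q
  have h2 := finrank_genCokerComp_add (K := k) (n := n) (M := M) q
  have : Module.Finite k ↥((columnSpan k n M M).restrictScalars k ⊓ homogeneousVectors k n M q) :=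
    Submodule.finiteDimensional_of_le inf_le_right
  have h3 := finrank_le_of_le_span_image _ _
    (columnSpan_inf_le_span_extendVector (k := k) (K := K) (n := n) (M := M) M q)
  have h4 := finrank_homogeneousVectors (K := K) (n := n) (M := M) q
  have h5 := finrank_homogeneousVectors (K := k) (n := n) (M := M) q
  omega

end BaseChange

open PowerSeries in
/-- For the module `F = Rⁿ/⟨columns of the generic n × ln matrix⟩` over
`R = k[x_{ij}]` (`ln²` variables), the Hilbert series of `F` equals
`[∑_{i=0}^{n-1} C(ln,i)·(n-i)·tⁱ·(1-t)^{n-1-i}] / (1-t)^{ln² - (l-1)n - 1}`,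
stated here multiplied through by `(1-t)^{ln² - (l-1)n - 1}` in `ℤ[[t]]`. -/
theorem statement18 (k : Type) [Field k] (n l : ℕ) (hn : 1 ≤ n) (hl : 1 ≤ l) :
    genCokerHilbert k n (l * n) * (1 - X) ^ (l * n ^ 2 - ((l - 1) * n + 1)) =
      ∑ i ∈ Finset.range n,
        (((l * n).choose i * (n - i) : ℕ) : PowerSeries ℤ) * X ^ i *
          (1 - X) ^ (n - 1 - i) := by
  have : NeZero n := ⟨by omega⟩
  let s : Fin (l * n) → AlgebraicClosure k := fun j => Infinite.natEmbedding _ (j : ℕ)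
  have hs : Function.Injective s := fun i j h =>
    Fin.ext ((Infinite.natEmbedding (AlgebraicClosure k)).injective h)
  have hH : genCokerHilbert k n (l * n) = (∑ i ∈ Finset.range n,
      (((l * n).choose i * (n - i) : ℕ) : PowerSeries ℤ) * (X * geomSeries) ^ i) *
        geomSeries ^ (n * (l * n) - l * n) := by
    ext q
    rw [genCokerHilbert, coeff_mk,
      finrank_genCokerComp_eq_of_algebra (K := AlgebraicClosure k),
      finrank_genCokerComp_of_injective hs]
  have hg : geomSeries * (1 - X) = 1 := mk_one_mul_one_sub_eq_one ℤ
  have hexp : l * n ^ 2 - ((l - 1) * n + 1) = (n * (l * n) - l * n) + (n - 1) := by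
    obtain ⟨l, rfl⟩ := Nat.exists_eq_add_of_le' hl
    obtain ⟨n, rfl⟩ := Nat.exists_eq_add_of_le' hn
    have h1 : (l + 1) * (n + 1) ^ 2 =
        ((l + 1 - 1) * (n + 1) + 1) + ((l + 1) * (n + 1) * n + n) := by
      rw [Nat.add_sub_cancel]; ring
    have h2 : (n + 1) * ((l + 1) * (n + 1)) = (l + 1) * (n + 1) + (l + 1) * (n + 1) * n := by ring
    rw [h1, h2]
    simp only [Nat.add_sub_cancel_left, Nat.add_sub_cancel]
  rw [hH, hexp, pow_add, mul_assoc, ← mul_assoc (geomSeries ^ _), ← mul_pow, hg, one_pow, one_mul,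
    Finset.sum_mul]
  refine Finset.sum_congr rfl fun i hi => ?_
  have hin : n - 1 = i + (n - 1 - i) := by have := Finset.mem_range.1 hi; omega
  conv_lhs => rw [hin]
  rw [pow_add, mul_pow]
  have hgi : geomSeries ^ i * (1 - X) ^ i = 1 := by rw [← mul_pow, hg, one_pow]
  linear_combination (((l * n).choose i * (n - i) : ℕ) : PowerSeries ℤ) * X ^ i *
    (1 - X) ^ (n - 1 - i) * hgi
end

section
/- Let k be a field, n ≥ 1, l ≥ 1, R = k[x_{ij} : 1 ≤ i ≤ n, 1 ≤ j ≤ ln] the polynomial ring in ln² variables graded with each x_{ij} of degree 1, X = (x_{ij}) the generic n × (ln) matrix, and F the graded R-module R^n / ⟨columns of X⟩. Then the Betti numbers b_i = dim_k Tor_i^R(k, F) are: b_0 = n, b_1 = ln, b_i = C(ln, n+i−1)·C(n+i−3, n−1) for 2 ≤ i ≤ (l−1)n+1, and b_i = 0 for i > (l−1)n+1; moreover in the minimal graded free resolution of F the i-th free module has all its generators in degree 0 for i = 0, in degree 1 for i = 1, and in degree n+i−1 for i ≥ 2; in particular the projective dimension of F is (l−1)n+1 (for l > 1) and the last Betti number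 equals C(ln−2, n−1). -/
noncomputable section

/-- The Betti numbers of `F`: `b₀ = n`, `b₁ = ln`,
`b_i = C(ln, n+i-1)·C(n+i-3, n-1)` for `2 ≤ i ≤ (l-1)n+1`, and `b_i = 0` beyond. -/
def bettiB (n l : ℕ) : ℕ → ℕ := fun i =>
  if i = 0 then n
  else if i = 1 then l * n
  else if i ≤ (l - 1) * n + 1 then (l * n).choose (n + i - 1) * (n + i - 3).choose (n - 1)
  else 0

/-- The degree of the generators of the `i`-th module in the minimal graded free
resolution: `0` for `i = 0`, `1` for `i = 1`, `n+i-1` for `i ≥ 2`. -/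
def degD (n : ℕ) : ℕ → ℕ := fun i =>
  if i = 0 then 0 else if i = 1 then 1 else n + i - 1

end

namespace GenericWedge

open MvPolynomial

section Wedge

variable {A : Type*} [CommRing A] {m : ℕ}

/-- The sign of moving the `j`-th basis vector to its place in the monomial indexed by `S`. -/
def sgn (A : Type*) [CommRing A] {m : ℕ} (j : Fin m) (S : Finset (Fin m)) : A :=
  (-1) ^ (S.filter (· < j)).card

theorem sgn_mul_self (j : Fin m) (S : Finset (Fin m)) : sgn A j S * sgn A j S = 1 := by
  rw [sgn, ← mul_pow]; simp

theorem sgn_insert_self (j : Fin m) (S : Finset (Fin m)) :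
    sgn A j (insert j S) = sgn A j S := by
  rw [sgn, sgn, Finset.filter_insert, if_neg (lt_irrefl j)]

theorem sgn_erase_of_lt {j c : Fin m} {S : Finset (Fin m)} (h : j < c) :
    sgn A j (S.erase c) = sgn A j S := by
  rw [sgn, sgn, Finset.filter_erase, Finset.erase_eq_of_notMem]
  simp [h.le]

theorem sgn_erase_of_gt {j c : Fin m} {S : Finset (Fin m)} (h : j < c) (hj : j ∈ S) :
    sgn A c (S.erase j) = - sgn A c S := by
  have hmem : j ∈ S.filter (· < c) := by simp [h, hj]
  rw [sgn, sgn, Finset.filter_erase, ← Finset.card_erase_add_one hmem, pow_succ]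
  ring

theorem sgn_anticomm {j c : Fin m} {S : Finset (Fin m)} (h : j ≠ c) (hj : j ∈ S) (hc : c ∈ S) :
    sgn A j S * sgn A c (S.erase j) = - (sgn A c S * sgn A j (S.erase c)) := by
  rcases lt_or_gt_of_ne h with h | h
  · rw [sgn_erase_of_lt h, sgn_erase_of_gt h hj]; ring
  · rw [sgn_erase_of_lt h, sgn_erase_of_gt h hc]; ring

/-- Exterior multiplication by the vector `r` on the exterior algebra of `A ^ m`, whose elements
are given by their coordinates with respect to the monomial basis. -/
def wedge (r : Fin m → A) : (Finset (Fin m) → A) →ₗ[A] (Finset (Fin m) → A) where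
  toFun ω S := ∑ j ∈ S, sgn A j S * r j * ω (S.erase j)
  map_add' ω η := by
    ext S; simp [mul_add, Finset.sum_add_distrib]
  map_smul' a ω := by
    ext S
    simp only [Pi.smul_apply, smul_eq_mul, RingHom.id_apply, Finset.mul_sum]
    exact Finset.sum_congr rfl fun _ _ => by ring

theorem wedge_apply (r : Fin m → A) (ω : Finset (Fin m) → A) (S : Finset (Fin m)) :
    wedge r ω S = ∑ j ∈ S, sgn A j S * r j * ω (S.erase j) := rfl

theorem wedge_wedge (r : Fin m → A) (ω : Finset (Fin m) → A) : wedge r (wedge r ω) = 0 := by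
  ext S
  simp only [wedge_apply, Finset.mul_sum, Pi.zero_apply]
  rw [Finset.sum_sigma']
  refine Finset.sum_involution (fun p _ => ⟨p.2, p.1⟩) ?_ ?_ ?_ ?_
  · rintro ⟨j, c⟩ h
    simp only [Finset.mem_sigma, Finset.mem_erase] at h
    obtain ⟨hj, hcj, hc⟩ := h
    have := sgn_anticomm (A := A) (Ne.symm hcj) hj hc
    simp only
    rw [Finset.erase_right_comm (a := c)]
    linear_combination r j * r c * ω ((S.erase j).erase c) * this
  · rintro ⟨j, c⟩ h _ he
    simp only [Finset.mem_sigma, Finset.mem_erase] at h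
    simp only [Sigma.mk.injEq] at he
    exact h.2.1 he.1
  · rintro ⟨j, c⟩ h
    simp only [Finset.mem_sigma, Finset.mem_erase] at h ⊢
    exact ⟨h.2.2, Ne.symm h.2.1, h.1⟩
  · rintro ⟨j, c⟩ _
    rfl

theorem wedge_add (r s : Fin m → A) : wedge (r + s) = wedge r + wedge s := by
  ext ω S
  simp [wedge_apply, mul_add, add_mul, Finset.sum_add_distrib]

theorem wedge_anticomm (r s : Fin m → A) (ω : Finset (Fin m) → A) :
    wedge r (wedge s ω) = - wedge s (wedge r ω) := by
  have h := wedge_wedge (r + s) ω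
  simp only [wedge_add, LinearMap.add_apply, map_add, wedge_wedge, zero_add, add_zero] at h
  exact eq_neg_of_add_eq_zero_right h

/-- The elements of exterior degree less than `q`. -/
def DegLT (q : ℕ) (ω : Finset (Fin m) → A) : Prop := ∀ S, q ≤ S.card → ω S = 0

theorem DegLT.add {q : ℕ} {ω η : Finset (Fin m) → A} (hω : DegLT q ω) (hη : DegLT q η) :
    DegLT q (ω + η) := fun S hS => by simp [hω S hS, hη S hS]

theorem DegLT.wedge {q : ℕ} {ω : Finset (Fin m) → A} (hω : DegLT q ω) (r : Fin m → A) :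
    DegLT (q + 1) (wedge r ω) := fun S hS => by
  rw [wedge_apply]
  refine Finset.sum_eq_zero fun j hj => ?_
  rw [hω _ (by rw [Finset.card_erase_of_mem hj]; omega), mul_zero]

/-- Discard the coordinates indexed by sets whose cardinality does not satisfy `P`. -/
def cardFilter (P : ℕ → Prop) [DecidablePred P] :
    (Finset (Fin m) → A) →ₗ[A] (Finset (Fin m) → A) where
  toFun ω S := if P S.card then ω S else 0
  map_add' ω η := by ext S; by_cases h : P S.card <;> simp [h]
  map_smul' a ω := by ext S; by_cases h : P S.card <;> simp [h]

theorem cardFilter_apply (P : ℕ → Prop) [DecidablePred P] (ω : Finset (Fin m) → A)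
    (S : Finset (Fin m)) : cardFilter P ω S = if P S.card then ω S else 0 := rfl

theorem cardFilter_wedge (P Q : ℕ → Prop) [DecidablePred P] [DecidablePred Q]
    (h : ∀ c, P c ↔ Q (c + 1)) (r : Fin m → A) (ω : Finset (Fin m) → A) :
    cardFilter Q (wedge r ω) = wedge r (cardFilter P ω) := by
  ext S
  simp only [cardFilter_apply, wedge_apply]
  rw [← Finset.sum_filter_add_sum_filter_not S (fun _ => Q S.card)]
  by_cases hS : Q S.card
  · simp only [hS, if_true, Finset.filter_true, not_true, Finset.filter_false,
      Finset.sum_empty, add_zero]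
    refine Finset.sum_congr rfl fun j hj => ?_
    rw [if_pos]
    rwa [h, Finset.card_erase_add_one hj]
  · simp only [hS, if_false, Finset.filter_false, not_false_iff, Finset.filter_true,
      Finset.sum_empty, zero_add]
    refine (Finset.sum_eq_zero fun j hj => ?_).symm
    rw [if_neg, mul_zero]
    rwa [h, Finset.card_erase_add_one hj]

theorem degLT_cardFilter (q : ℕ) (ω : Finset (Fin m) → A) : DegLT q (cardFilter (· < q) ω) :=
  fun S hS => by rw [cardFilter_apply, if_neg (by omega)]

theorem DegLT.cardFilter_eq {q : ℕ} {ω : Finset (Fin m) → A} (hω : DegLT q ω) :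
    cardFilter (· < q) ω = ω := by
  ext S
  rw [cardFilter_apply]
  split_ifs with h
  · rfl
  · rw [hω S (by omega)]

end Wedge

noncomputable section Generic

variable {k : Type} [CommRing k] {n m : ℕ}

/-- Exterior multiplication by the `i`-th row of the generic matrix. -/
def rowWedge (k : Type) [CommRing k] {n m : ℕ} (i : Fin n) :
    (Finset (Fin m) → MvPolynomial (Fin n × Fin m) k) →ₗ[MvPolynomial (Fin n × Fin m) k]
      (Finset (Fin m) → MvPolynomial (Fin n × Fin m) k) :=
  wedge fun j => X (i, j)

/-- The total degree of a monomial in the variables of row `l`. -/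
def rowDeg (l : Fin n) (d : Fin n × Fin m →₀ ℕ) : ℕ := ∑ j, d (l, j)

/-- The part of a polynomial of degree less than `a` in the variables of row `l`. -/
def truncRow (l : Fin n) (a : ℕ) (f : MvPolynomial (Fin n × Fin m) k) :
    MvPolynomial (Fin n × Fin m) k :=
  ∑ d ∈ f.support.filter (fun d => rowDeg l d < a), monomial d (coeff d f)

theorem coeff_truncRow (l : Fin n) (a : ℕ) (f : MvPolynomial (Fin n × Fin m) k)
    (d : Fin n × Fin m →₀ ℕ) :
    coeff d (truncRow l a f) = if rowDeg l d < a then coeff d f else 0 := by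
  classical
  rw [truncRow, coeff_sum]
  simp only [coeff_monomial, Finset.sum_ite_eq', Finset.mem_filter, mem_support_iff]
  by_cases h : coeff d f = 0 <;> simp [h]

theorem truncRow_add (l : Fin n) (a : ℕ) (f g : MvPolynomial (Fin n × Fin m) k) :
    truncRow l a (f + g) = truncRow l a f + truncRow l a g := by
  ext d
  simp only [coeff_truncRow, coeff_add]
  split_ifs <;> simp

theorem truncRow_neg (l : Fin n) (a : ℕ) (f : MvPolynomial (Fin n × Fin m) k) :
    truncRow l a (-f) = -truncRow l a f := by
  ext d
  simp only [coeff_truncRow, coeff_neg]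
  split_ifs <;> simp

theorem truncRow_zero (l : Fin n) (f : MvPolynomial (Fin n × Fin m) k) :
    truncRow l 0 f = 0 := by
  ext d
  simp [coeff_truncRow]

/-- The additive map truncating a polynomial in its degree with respect to row `l`. -/
def truncRowHom (l : Fin n) (a : ℕ) :
    MvPolynomial (Fin n × Fin m) k →+ MvPolynomial (Fin n × Fin m) k :=
  AddMonoidHom.mk' (truncRow l a) (truncRow_add l a)

theorem truncRowHom_apply (l : Fin n) (a : ℕ) (f : MvPolynomial (Fin n × Fin m) k) :
    truncRowHom l a f = truncRow l a f := rfl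

theorem rowDeg_add (l : Fin n) (d e : Fin n × Fin m →₀ ℕ) :
    rowDeg l (d + e) = rowDeg l d + rowDeg l e := by
  simp [rowDeg, Finset.sum_add_distrib]

theorem rowDeg_single (l i : Fin n) (j : Fin m) :
    rowDeg l (Finsupp.single (i, j) 1) = if i = l then 1 else 0 := by
  simp only [rowDeg, Finsupp.single_apply, Prod.mk.injEq]
  by_cases h : i = l <;> simp [h]

theorem truncRow_X_mul (l i : Fin n) (j : Fin m) (a b : ℕ)
    (hab : a = b + if i = l then 1 else 0) (f : MvPolynomial (Fin n × Fin m) k) :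
    truncRow l a (X (i, j) * f) = X (i, j) * truncRow l b f := by
  classical
  ext d
  rw [coeff_truncRow, coeff_X_mul', coeff_X_mul', coeff_truncRow]
  by_cases hd : (i, j) ∈ d.support
  · have hle : Finsupp.single (i, j) 1 ≤ d := by
      rw [Finsupp.single_le_iff]
      exact Nat.one_le_iff_ne_zero.2 (Finsupp.mem_support_iff.1 hd)
    have hdeg : rowDeg l d = rowDeg l (d - Finsupp.single (i, j) 1) + if i = l then 1 else 0 := by
      rw [← rowDeg_single l i j, ← rowDeg_add, tsub_add_cancel_of_le hle]
    simp only [hd, if_true]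
    rw [hdeg, hab]
    simp only [Nat.add_lt_add_iff_right]
  · simp [hd]

theorem exists_truncRow_eq (l : Fin n) (ω : Finset (Fin m) → MvPolynomial (Fin n × Fin m) k) :
    ∃ a, ∀ S, truncRow l a (ω S) = ω S := by
  refine ⟨(Finset.univ.sup fun S => (ω S).support.sup (rowDeg l)) + 1, fun S => ?_⟩
  ext d
  rw [coeff_truncRow]
  split_ifs with h
  · rfl
  · by_contra hne
    refine h (Nat.lt_succ_of_le ?_)
    refine le_trans ?_ (Finset.le_sup (f := fun S => (ω S).support.sup (rowDeg l))
      (Finset.mem_univ S))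
    exact Finset.le_sup (f := rowDeg l) (mem_support_iff.2 (Ne.symm hne))

theorem sgn_mul_X_mul_truncRow (l i : Fin n) (a b : ℕ) (hab : a = b + if i = l then 1 else 0)
    (j : Fin m) (S : Finset (Fin m)) (f : MvPolynomial (Fin n × Fin m) k) :
    truncRow l a (sgn _ j S * X (i, j) * f) = sgn _ j S * X (i, j) * truncRow l b f := by
  rw [sgn]
  rcases neg_one_pow_eq_or (MvPolynomial (Fin n × Fin m) k) (S.filter (· < j)).card with h | h
  · rw [h, one_mul, truncRow_X_mul l i j a b hab]
  · rw [h, neg_one_mul, neg_mul, neg_mul, truncRow_neg, truncRow_X_mul l i j a b hab]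

theorem truncRow_rowWedge (l i : Fin n) (a b : ℕ) (hab : a = b + if i = l then 1 else 0)
    (ω : Finset (Fin m) → MvPolynomial (Fin n × Fin m) k) :
    (fun S => truncRow l a (rowWedge k i ω S)) = rowWedge k i (fun S => truncRow l b (ω S)) := by
  ext1 S
  simp only [rowWedge, wedge_apply]
  rw [← truncRowHom_apply, map_sum]
  exact Finset.sum_congr rfl fun j _ => sgn_mul_X_mul_truncRow l i a b hab j S _

/-- Division of a polynomial by a variable, discarding the remainder. -/
def divX (v : Fin n × Fin m) :
    MvPolynomial (Fin n × Fin m) k →+ MvPolynomial (Fin n × Fin m) k :=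
  AddMonoidHom.mk' (fun f => f.divMonomial (Finsupp.single v 1))
    fun f g => add_divMonomial f g _

theorem divX_X_mul (v : Fin n × Fin m) (f : MvPolynomial (Fin n × Fin m) k) :
    divX v (X v * f) = f := X_mul_divMonomial v f

theorem divX_X_mul_of_ne {u v : Fin n × Fin m} (h : u ≠ v)
    (f : MvPolynomial (Fin n × Fin m) k) : divX v (X u * f) = X u * divX v f := by
  classical
  ext d
  change coeff d (MvPolynomial.divMonomial _ _) = coeff d (_ * MvPolynomial.divMonomial _ _)
  rw [coeff_divMonomial, coeff_X_mul', coeff_X_mul', coeff_divMonomial]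
  have hs : (u ∈ (Finsupp.single v 1 + d).support) = (u ∈ d.support) := by
    simp [h.symm]
  simp only [hs]
  split_ifs with hd
  · congr 1
    rw [add_tsub_assoc_of_le]
    rw [Finsupp.single_le_iff]
    exact Nat.one_le_iff_ne_zero.2 (Finsupp.mem_support_iff.1 hd)
  · rfl

theorem divX_sgn_mul (v : Fin n × Fin m) (j : Fin m) (S : Finset (Fin m))
    (f : MvPolynomial (Fin n × Fin m) k) : divX v (sgn _ j S * f) = sgn _ j S * divX v f := by
  rw [sgn]
  rcases neg_one_pow_eq_or (MvPolynomial (Fin n × Fin m) k) (S.filter (· < j)).card with h | h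
  · rw [h, one_mul, one_mul]
  · rw [h, neg_one_mul, neg_one_mul, map_neg]

/-- Contraction with the `j`-th coordinate combined with division by the `j`-th variable of
row `i`. -/
def contract (i : Fin n) (j : Fin m) (ω : Finset (Fin m) → MvPolynomial (Fin n × Fin m) k) :
    Finset (Fin m) → MvPolynomial (Fin n × Fin m) k :=
  fun S => if j ∈ S then 0 else sgn _ j S * divX (i, j) (ω (insert j S))

theorem rowWedge_contract (i : Fin n) (j : Fin m)
    (ω : Finset (Fin m) → MvPolynomial (Fin n × Fin m) k) (S : Finset (Fin m)) (hj : j ∉ S) :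
    rowWedge k i (contract i j ω) S + contract i j (rowWedge k i ω) S = ω S := by
  simp only [rowWedge, wedge_apply, contract, if_neg hj]
  rw [Finset.sum_insert hj, map_add, mul_add, Finset.erase_insert hj, mul_assoc, divX_sgn_mul,
    divX_X_mul, sgn_insert_self, ← mul_assoc, sgn_mul_self, one_mul, map_sum, Finset.mul_sum,
    add_left_comm, ← Finset.sum_add_distrib, Finset.sum_eq_zero, add_zero]
  intro c hc
  have hcj : c ≠ j := fun h => hj (h ▸ hc)
  have hne : ((i, c) : Fin n × Fin m) ≠ (i, j) := by simpa using hcj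
  rw [if_neg (fun h => hj (Finset.mem_of_mem_erase h)), mul_assoc (sgn _ c (insert j S)), divX_sgn_mul,
    divX_X_mul_of_ne hne, Finset.erase_insert_of_ne hcj.symm]
  have hs := sgn_anticomm (A := MvPolynomial (Fin n × Fin m) k) hcj
    (Finset.mem_insert_of_mem (b := j) hc) (Finset.mem_insert_self j S)
  rw [Finset.erase_insert hj, sgn_insert_self, Finset.erase_insert_of_ne hcj.symm,
    sgn_insert_self] at hs
  have h1 := sgn_mul_self (A := MvPolynomial (Fin n × Fin m) k) c S
  have h2 := sgn_mul_self (A := MvPolynomial (Fin n × Fin m) k) c (insert j S)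
  linear_combination (sgn _ c S * sgn _ c (insert j S) * X (i, c) *
    divX (i, j) (ω (insert j (S.erase c)))) * hs -
    sgn _ j (S.erase c) * sgn _ c S * X (i, c) *
      divX (i, j) (ω (insert j (S.erase c))) * h2 - sgn _ j S * sgn _ c (insert j S) * X (i, c) *
      divX (i, j) (ω (insert j (S.erase c))) * h1

end Generic

noncomputable section Exactness

variable {k : Type} [CommRing k] {n m : ℕ}

theorem rowWedge_anticomm (i j : Fin n) (ω : Finset (Fin m) → MvPolynomial (Fin n × Fin m) k) :
    rowWedge k i (rowWedge k j ω) = - rowWedge k j (rowWedge k i ω) := wedge_anticomm _ _ _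

theorem rowWedge_self (i : Fin n) (ω : Finset (Fin m) → MvPolynomial (Fin n × Fin m) k) :
    rowWedge k i (rowWedge k i ω) = 0 := wedge_wedge _ _

/-- The ideal of the exterior algebra generated by the rows with index in `J`. -/
def rowSpan (k : Type) [CommRing k] {n : ℕ} (m : ℕ) (J : Finset (Fin n)) :
    Submodule (MvPolynomial (Fin n × Fin m) k)
      (Finset (Fin m) → MvPolynomial (Fin n × Fin m) k) :=
  ⨆ i ∈ J, LinearMap.range (rowWedge k i)

theorem rowSpan_empty : rowSpan k m (∅ : Finset (Fin n)) = ⊥ := by simp [rowSpan]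

theorem rowSpan_insert (i : Fin n) (J : Finset (Fin n)) :
    rowSpan k m (insert i J) = LinearMap.range (rowWedge k i) ⊔ rowSpan k m J :=
  Finset.iSup_insert i J _

theorem mem_rowSpan_insert {i : Fin n} {J : Finset (Fin n)}
    {ω : Finset (Fin m) → MvPolynomial (Fin n × Fin m) k} :
    ω ∈ rowSpan k m (insert i J) ↔ ∃ ζ, ∃ u ∈ rowSpan k m J, rowWedge k i ζ + u = ω := by
  simp only [rowSpan_insert, Submodule.mem_sup, LinearMap.mem_range, exists_exists_eq_and]

theorem rowSpan_mono {J K : Finset (Fin n)} (h : J ⊆ K) : rowSpan k m J ≤ rowSpan k m K :=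
  biSup_mono fun _ hi => h hi

theorem rowWedge_mem_rowSpan {i : Fin n} {J : Finset (Fin n)} (hi : i ∈ J)
    (ω : Finset (Fin m) → MvPolynomial (Fin n × Fin m) k) : rowWedge k i ω ∈ rowSpan k m J :=
  Submodule.mem_iSup_of_mem i (Submodule.mem_iSup_of_mem hi ⟨ω, rfl⟩)

theorem mem_rowSpan_iff {J : Finset (Fin n)}
    {ω : Finset (Fin m) → MvPolynomial (Fin n × Fin m) k} :
    ω ∈ rowSpan k m J ↔ ∃ ζ : Fin n → Finset (Fin m) → MvPolynomial (Fin n × Fin m) k,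
      ∑ i ∈ J, rowWedge k i (ζ i) = ω := by
  classical
  constructor
  · induction J using Finset.induction_on generalizing ω with
    | empty =>
      intro h
      rw [rowSpan_empty, Submodule.mem_bot] at h
      exact ⟨0, by simp [h]⟩
    | insert i J hi ih =>
      intro h
      obtain ⟨ζ, u, hu, rfl⟩ := mem_rowSpan_insert.1 h
      obtain ⟨η, rfl⟩ := ih hu
      refine ⟨Function.update η i ζ, ?_⟩
      rw [Finset.sum_insert hi, Function.update_self]
      congr 1
      refine Finset.sum_congr rfl fun j hj => ?_
      rw [Function.update_of_ne (ne_of_mem_of_not_mem hj hi)]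
  · rintro ⟨ζ, rfl⟩
    exact Submodule.sum_mem _ fun i hi => rowWedge_mem_rowSpan hi _

theorem rowWedge_mem_rowSpan_of_mem (l : Fin n) {J : Finset (Fin n)}
    {ω : Finset (Fin m) → MvPolynomial (Fin n × Fin m) k} (h : ω ∈ rowSpan k m J) :
    rowWedge k l ω ∈ rowSpan k m J := by
  obtain ⟨ζ, rfl⟩ := mem_rowSpan_iff.1 h
  rw [map_sum]
  refine Submodule.sum_mem _ fun i hi => ?_
  rw [rowWedge_anticomm]
  exact Submodule.neg_mem _ (rowWedge_mem_rowSpan hi _)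

theorem DegLT.rowWedge {q : ℕ} {ω : Finset (Fin m) → MvPolynomial (Fin n × Fin m) k}
    (hω : DegLT q ω) (i : Fin n) : DegLT (q + 1) (rowWedge k i ω) := DegLT.wedge hω _

theorem cardFilter_rowWedge (i : Fin n) (q : ℕ)
    (ω : Finset (Fin m) → MvPolynomial (Fin n × Fin m) k) :
    cardFilter (· < q) (rowWedge k i ω) = rowWedge k i (cardFilter (· < q - 1) ω) :=
  cardFilter_wedge _ _ (fun c => by omega) _ _

theorem cardFilter_mem_rowSpan (q : ℕ) {J : Finset (Fin n)}
    {ω : Finset (Fin m) → MvPolynomial (Fin n × Fin m) k} (h : ω ∈ rowSpan k m J) :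
    cardFilter (· < q) ω ∈ rowSpan k m J := by
  obtain ⟨ζ, rfl⟩ := mem_rowSpan_iff.1 h
  rw [map_sum]
  refine Submodule.sum_mem _ fun i hi => ?_
  rw [cardFilter_rowWedge]
  exact rowWedge_mem_rowSpan hi _

theorem truncRow_mem_rowSpan (l : Fin n) (a : ℕ) {J : Finset (Fin n)} (hl : l ∉ J)
    {ω : Finset (Fin m) → MvPolynomial (Fin n × Fin m) k} (h : ω ∈ rowSpan k m J) :
    (fun S => truncRow l a (ω S)) ∈ rowSpan k m J := by
  obtain ⟨ζ, rfl⟩ := mem_rowSpan_iff.1 h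
  refine mem_rowSpan_iff.2 ⟨fun i S => truncRow l a (ζ i S), ?_⟩
  ext1 S
  rw [Finset.sum_apply, Finset.sum_apply, ← truncRowHom_apply, map_sum]
  refine Finset.sum_congr rfl fun i hi => ?_
  have hil : i ≠ l := fun h => hl (h ▸ hi)
  rw [← truncRow_rowWedge l i a a (by simp [hil])]
  rfl

/-- Exactness of the Koszul complex of the variables of one row below the top degree. -/
theorem koszul_exact (i : Fin n) {q : ℕ} (hq : q ≤ m)
    {ω : Finset (Fin m) → MvPolynomial (Fin n × Fin m) k} (hω : DegLT q ω)
    (h : rowWedge k i ω = 0) : ω ∈ LinearMap.range (rowWedge (m := m) k i) := by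
  classical
  have key : ∀ J : Finset (Fin m), ∃ η, DegLT q η ∧ rowWedge k i η = 0 ∧
      (∀ S, ¬ J ⊆ S → η S = 0) ∧ ω - η ∈ LinearMap.range (rowWedge (m := m) k i) := by
    intro J
    induction J using Finset.induction_on with
    | empty => exact ⟨ω, hω, h, fun S hS => absurd (Finset.empty_subset S) hS, by simp⟩
    | insert j J hj ih =>
      obtain ⟨η, h1, h2, h3, h4⟩ := ih
      refine ⟨η - rowWedge k i (contract i j η), ?_, ?_, ?_, ?_⟩
      · intro S hS
        rw [Pi.sub_apply, h1 S hS, zero_sub, neg_eq_zero, rowWedge, wedge_apply]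
        refine Finset.sum_eq_zero fun c hc => ?_
        rw [contract]
        split_ifs with hjc
        · rw [mul_zero]
        · rw [h1, map_zero, mul_zero, mul_zero]
          rw [Finset.card_insert_of_notMem hjc, Finset.card_erase_add_one hc]
          exact hS
      · rw [map_sub, h2, rowWedge_self, sub_zero]
      · intro S hS
        by_cases hjS : j ∈ S
        · have hJ : ¬ J ⊆ S := fun hJ => hS (Finset.insert_subset hjS hJ)
          obtain ⟨c, hcJ, hcS⟩ := Finset.not_subset.1 hJ
          rw [Pi.sub_apply, h3 S hJ, zero_sub, neg_eq_zero, rowWedge, wedge_apply]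
          refine Finset.sum_eq_zero fun d hd => ?_
          rw [contract]
          split_ifs with hjc
          · rw [mul_zero]
          · rw [h3, map_zero, mul_zero, mul_zero]
            intro hsub
            rcases Finset.mem_insert.1 (hsub hcJ) with rfl | hc
            · exact hcS hjS
            · exact hcS (Finset.mem_of_mem_erase hc)
        · have := rowWedge_contract i j η S hjS
          rw [h2] at this
          simp only [contract, Pi.zero_apply, map_zero, mul_zero, ite_self, add_zero] at this
          rw [Pi.sub_apply, sub_eq_zero]
          exact this.symm
      · rw [sub_sub_eq_add_sub, add_sub_right_comm]
        exact Submodule.add_mem _ h4 ⟨_, rfl⟩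
  obtain ⟨η, h1, -, h3, h4⟩ := key Finset.univ
  have : η = 0 := by
    ext1 S
    by_cases hS : Finset.univ ⊆ S
    · rw [Finset.univ_subset_iff.1 hS]
      exact h1 _ (by simpa using hq)
    · exact h3 S hS
  simpa [this] using h4

theorem mem_rowSpan_of_rowWedge_mem (N : ℕ) : ∀ (J : Finset (Fin n)), J.card = N →
    ∀ i ∉ J, ∀ (q : ℕ), q + N ≤ m → ∀ ω : Finset (Fin m) → MvPolynomial (Fin n × Fin m) k,
      DegLT q ω → rowWedge k i ω ∈ rowSpan k m J → ω ∈ rowSpan k m (insert i J) := by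
  classical
  induction N with
  | zero =>
    intro J hJ i hi q hq ω hω h
    obtain rfl := Finset.card_eq_zero.1 hJ
    rw [rowSpan_empty, Submodule.mem_bot] at h
    rw [rowSpan_insert, rowSpan_empty, sup_bot_eq]
    exact koszul_exact i hq hω h
  | succ N ih =>
    intro K hK i hi q hq
    obtain ⟨l, J, hl, rfl, hJ⟩ := Finset.card_eq_succ.1 hK
    rw [Finset.mem_insert, not_or] at hi
    obtain ⟨hil, hiJ⟩ := hi
    have key : ∀ (a : ℕ) (ω : Finset (Fin m) → MvPolynomial (Fin n × Fin m) k),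
        (∀ S, truncRow l a (ω S) = ω S) → DegLT q ω →
        rowWedge k i ω ∈ rowSpan k m (insert l J) →
        ω ∈ rowSpan k m (insert i (insert l J)) := by
      intro a
      induction a with
      | zero =>
        intro ω ha _ _
        have : ω = 0 := by
          ext1 S
          rw [← ha S, truncRow_zero]
          rfl
        rw [this]
        exact Submodule.zero_mem _
      | succ a iha =>
        intro ω ha hω h
        obtain ⟨η₀, u₀, hu₀, h₀⟩ := mem_rowSpan_insert.1 h
        set η₁ : Finset (Fin m) → MvPolynomial (Fin n × Fin m) k :=
          fun S => truncRow l a (η₀ S) with hη₁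
        set u₁ : Finset (Fin m) → MvPolynomial (Fin n × Fin m) k :=
          fun S => truncRow l (a + 1) (u₀ S) with hu₁
        have h₁ : rowWedge k l η₁ + u₁ = rowWedge k i ω := by
          have hω' : (fun S => truncRow l (a + 1) (ω S)) = ω := funext ha
          rw [← hω', ← truncRow_rowWedge l i (a + 1) (a + 1) (by simp [hil]), ← h₀, hη₁,
            ← truncRow_rowWedge l l (a + 1) a (by simp)]
          ext1 S
          simp only [Pi.add_apply, truncRow_add, hu₁]
        set η := cardFilter (· < q) η₁ with hη
        set u := cardFilter (· < q + 1) u₁ with hu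
        have h₂ : rowWedge k l η + u = rowWedge k i ω := by
          rw [← (hω.rowWedge i).cardFilter_eq, ← h₁, map_add, cardFilter_rowWedge]
          rfl
        have huJ : u ∈ rowSpan k m J :=
          cardFilter_mem_rowSpan _ (truncRow_mem_rowSpan l _ hl hu₀)
        have hηq : DegLT q η := degLT_cardFilter q _
        have hηa : ∀ S, truncRow l a (η S) = η S := by
          intro S
          rw [hη, cardFilter_apply]
          split_ifs
          · ext d
            simp only [hη₁, coeff_truncRow]
            split_ifs <;> rfl
          · rw [← truncRowHom_apply, map_zero]
        have h₃ : rowWedge k l (rowWedge k i η) ∈ rowSpan k m J := by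
          have : rowWedge k l (rowWedge k i η) = rowWedge k i u := by
            rw [rowWedge_anticomm, neg_eq_iff_add_eq_zero, ← map_add, h₂, rowWedge_self]
          rw [this]
          exact rowWedge_mem_rowSpan_of_mem i huJ
        have h₄ : rowWedge k i η ∈ rowSpan k m (insert l J) :=
          ih J hJ l hl (q + 1) (by omega) _ (hηq.rowWedge i) h₃
        obtain ⟨ζ, v, hv, hζ⟩ := mem_rowSpan_insert.1 (iha η hηa hηq h₄)
        obtain ⟨ζ', w, hw, hv'⟩ := mem_rowSpan_insert.1 (cardFilter_mem_rowSpan q hv)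
        have hη' : rowWedge k i (cardFilter (· < q - 1) ζ) + (rowWedge k l ζ' + w) = η := by
          rw [hv', ← cardFilter_rowWedge, ← map_add, hζ, hηq.cardFilter_eq]
        set ξ := cardFilter (· < q - 1) ζ with hξ
        have h₅ : rowWedge k i (ω + rowWedge k l ξ) = rowWedge k l w + u := by
          rw [map_add, ← h₂, ← hη', map_add, map_add, rowWedge_self, rowWedge_anticomm i l]
          abel
        have h₆ : ω + rowWedge k l ξ ∈ rowSpan k m (insert i J) := by
          refine ih J hJ i hiJ q (by omega) _ (hω.add ?_) ?_
          · rw [hξ, ← cardFilter_rowWedge]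
            exact degLT_cardFilter q _
          · rw [h₅]
            exact Submodule.add_mem _ (rowWedge_mem_rowSpan_of_mem l hw) huJ
        have h₇ := rowSpan_mono (k := k) (m := m)
          (Finset.insert_subset_insert i (Finset.subset_insert l J)) h₆
        have h₈ : rowWedge k l ξ ∈ rowSpan k m (insert i (insert l J)) :=
          rowWedge_mem_rowSpan (by simp) _
        simpa using Submodule.sub_mem _ h₇ h₈
    intro ω hω h
    obtain ⟨a, ha⟩ := exists_truncRow_eq l ω
    exact key a ω ha hω h

end Exactness

noncomputable section Strand

variable {k : Type} [CommRing k] {n m : ℕ}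

/-- Exterior multiplication by the product of the rows in a list. -/
def rowProd (k : Type) [CommRing k] {n m : ℕ} : List (Fin n) →
    (Finset (Fin m) → MvPolynomial (Fin n × Fin m) k) →ₗ[MvPolynomial (Fin n × Fin m) k]
      (Finset (Fin m) → MvPolynomial (Fin n × Fin m) k)
  | [] => LinearMap.id
  | i :: L => rowWedge k i ∘ₗ rowProd k L

theorem rowProd_cons (i : Fin n) (L : List (Fin n))
    (ω : Finset (Fin m) → MvPolynomial (Fin n × Fin m) k) :
    rowProd k (i :: L) ω = rowWedge k i (rowProd k L ω) := rfl

theorem rowProd_rowWedge (i : Fin n) (L : List (Fin n))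
    (ω : Finset (Fin m) → MvPolynomial (Fin n × Fin m) k) :
    rowProd k L (rowWedge k i ω) =
      (-1 : MvPolynomial (Fin n × Fin m) k) ^ L.length • rowWedge k i (rowProd k L ω) := by
  induction L with
  | nil => simp [rowProd]
  | cons l L ih =>
    rw [rowProd_cons, rowProd_cons, ih, map_smul, rowWedge_anticomm l i, List.length_cons,
      pow_succ, smul_neg, mul_neg_one, neg_smul]

theorem rowProd_rowWedge_of_mem {i : Fin n} {L : List (Fin n)} (hi : i ∈ L)
    (ω : Finset (Fin m) → MvPolynomial (Fin n × Fin m) k) :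
    rowProd k L (rowWedge k i ω) = 0 := by
  induction L with
  | nil => simp at hi
  | cons l L ih =>
    rw [rowProd_cons]
    rcases List.mem_cons.1 hi with rfl | h
    · rw [rowProd_rowWedge, map_smul, rowWedge_self, smul_zero]
    · rw [ih h, map_zero]

theorem rowProd_eq_zero_of_mem_rowSpan {L : List (Fin n)} {J : Finset (Fin n)}
    (hJ : ∀ i ∈ J, i ∈ L) {ω : Finset (Fin m) → MvPolynomial (Fin n × Fin m) k}
    (h : ω ∈ rowSpan k m J) : rowProd k L ω = 0 := by
  obtain ⟨ζ, rfl⟩ := mem_rowSpan_iff.1 h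
  rw [map_sum]
  exact Finset.sum_eq_zero fun i hi => rowProd_rowWedge_of_mem (hJ i hi) _

theorem cardFilter_rowProd (L : List (Fin n)) (q : ℕ)
    (ω : Finset (Fin m) → MvPolynomial (Fin n × Fin m) k) :
    cardFilter (· < q) (rowProd k L ω) = rowProd k L (cardFilter (· < q - L.length) ω) := by
  induction L generalizing q with
  | nil => rfl
  | cons l L ih =>
    rw [rowProd_cons, rowProd_cons, cardFilter_rowWedge, ih]
    simp only [List.length_cons, Nat.sub_sub, Nat.add_comm 1]

/-- The de Rham–Saito division lemma for the rows of a generic matrix. -/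
theorem mem_rowSpan_of_rowProd_eq_zero {L : List (Fin n)} (hL : L.Nodup) {q : ℕ}
    (hq : q + L.length ≤ m + 1) {ω : Finset (Fin m) → MvPolynomial (Fin n × Fin m) k}
    (hω : DegLT q ω) (h : rowProd k L ω = 0) : ω ∈ rowSpan k m L.toFinset := by
  induction L generalizing q ω with
  | nil =>
    have : ω = 0 := h
    rw [this]
    exact Submodule.zero_mem _
  | cons i L ih =>
    rw [List.nodup_cons] at hL
    rw [List.length_cons] at hq
    have h₁ : rowProd k L (rowWedge k i ω) = 0 := by
      rw [rowProd_rowWedge, ← rowProd_cons, h, smul_zero]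
    rw [List.toFinset_cons]
    refine mem_rowSpan_of_rowWedge_mem L.length _ (List.toFinset_card_of_nodup hL.2) i
      (by simpa using hL.1) q (by omega) ω hω (ih hL.2 (by omega) (hω.rowWedge i) h₁)

/-- An element annihilated by all rows is divisible by their product. -/
theorem mem_range_rowProd {L : List (Fin n)} (hL : L.Nodup) {q : ℕ} (hq : q ≤ m)
    {ω : Finset (Fin m) → MvPolynomial (Fin n × Fin m) k} (hω : DegLT q ω)
    (h : ∀ i ∈ L, rowWedge k i ω = 0) : ∃ η, rowProd k L η = ω := by
  induction L with
  | nil => exact ⟨ω, rfl⟩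
  | cons i L ih =>
    obtain ⟨η₀, h₀⟩ := ih (List.nodup_cons.1 hL).2 fun j hj => h j (List.mem_cons_of_mem _ hj)
    set η := cardFilter (· < q - L.length) η₀ with hη
    have h₁ : rowProd k L η = ω := by
      rw [← cardFilter_rowProd, h₀, hω.cardFilter_eq]
    have h₂ : rowProd k (i :: L) η = 0 := by
      rw [rowProd_cons, h₁]
      exact h i List.mem_cons_self
    by_cases hqL : q ≤ L.length
    · have : η = 0 := by
        ext1 S
        exact degLT_cardFilter _ η₀ S (by omega)
      exact ⟨0, by rw [map_zero, ← h₁, this, map_zero]⟩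
    · have h₃ := mem_rowSpan_of_rowProd_eq_zero hL (q := q - L.length)
        (by rw [List.length_cons]; omega) (degLT_cardFilter _ η₀) h₂
      rw [List.toFinset_cons] at h₃
      obtain ⟨ζ, u, hu, hζ⟩ := mem_rowSpan_insert.1 h₃
      refine ⟨(-1 : MvPolynomial (Fin n × Fin m) k) ^ L.length • ζ, ?_⟩
      rw [← h₁, hη, ← hζ, map_add, rowProd_eq_zero_of_mem_rowSpan (by simp) hu, add_zero,
        rowProd_rowWedge, rowProd_cons, map_smul, map_smul]

/-- The differential on families of exterior elements indexed by monomials in dual variables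
attached to the rows. -/
def strandD (k : Type) [CommRing k] (n m : ℕ) :
    (Multiset (Fin n) → Finset (Fin m) → MvPolynomial (Fin n × Fin m) k)
      →ₗ[MvPolynomial (Fin n × Fin m) k]
      (Multiset (Fin n) → Finset (Fin m) → MvPolynomial (Fin n × Fin m) k) where
  toFun ω b := ∑ i, rowWedge k i (ω (i ::ₘ b))
  map_add' ω η := by
    ext1 b
    simp only [Pi.add_apply, map_add, Finset.sum_add_distrib]
  map_smul' a ω := by
    ext1 b
    simp only [Pi.smul_apply, map_smul, Finset.smul_sum, RingHom.id_apply]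

theorem strandD_apply (ω : Multiset (Fin n) → Finset (Fin m) → MvPolynomial (Fin n × Fin m) k)
    (b : Multiset (Fin n)) : strandD k n m ω b = ∑ i, rowWedge k i (ω (i ::ₘ b)) := rfl

theorem strandD_strandD
    (ω : Multiset (Fin n) → Finset (Fin m) → MvPolynomial (Fin n × Fin m) k) :
    strandD k n m (strandD k n m ω) = 0 := by
  ext1 b
  simp only [strandD_apply, map_sum, Pi.zero_apply]
  rw [← Finset.sum_product']
  refine Finset.sum_involution (fun p _ => p.swap) ?_ ?_ ?_ ?_
  · rintro ⟨i, j⟩ _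
    simp only [Prod.swap]
    rw [Multiset.cons_swap j i b, rowWedge_anticomm i j, neg_add_cancel]
  · rintro ⟨i, j⟩ _ hne he
    simp only [Prod.swap, Prod.mk.injEq] at he
    obtain ⟨rfl, -⟩ := he
    exact hne (rowWedge_self _ _)
  · simp
  · simp

theorem cardFilter_strandD (q : ℕ)
    (ω : Multiset (Fin n) → Finset (Fin m) → MvPolynomial (Fin n × Fin m) k) :
    (fun b => cardFilter (· < q) (strandD k n m ω b)) =
      strandD k n m fun a => cardFilter (· < q - 1) (ω a) := by
  ext1 b
  simp only [strandD_apply, map_sum, cardFilter_rowWedge]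

/-- Families supported on monomials of degree `j` in the variables from `J`. -/
def StrandSupp (j : ℕ) (J : Finset (Fin n))
    (ω : Multiset (Fin n) → Finset (Fin m) → MvPolynomial (Fin n × Fin m) k) : Prop :=
  ∀ a, ¬ (a.card = j ∧ ∀ x ∈ a, x ∈ J) → ω a = 0

theorem StrandSupp.strandD {j : ℕ} {J : Finset (Fin n)}
    {ω : Multiset (Fin n) → Finset (Fin m) → MvPolynomial (Fin n × Fin m) k}
    (h : StrandSupp (j + 1) J ω) : StrandSupp j J (strandD k n m ω) := by
  intro b hb
  rw [strandD_apply]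
  refine Finset.sum_eq_zero fun i _ => ?_
  rw [h, map_zero]
  rintro ⟨h1, h2⟩
  rw [Multiset.card_cons, add_left_inj] at h1
  exact hb ⟨h1, fun x hx => h2 x (Multiset.mem_cons_of_mem hx)⟩

theorem exists_strandD_eq_of_mem_rowSpan {J : Finset (Fin n)}
    {ω : Multiset (Fin n) → Finset (Fin m) → MvPolynomial (Fin n × Fin m) k}
    (hω : StrandSupp 0 J ω) (h : ω 0 ∈ rowSpan k m J) :
    ∃ ξ, StrandSupp 1 J ξ ∧ strandD k n m ξ = ω := by
  classical
  obtain ⟨ζ, hζ⟩ := mem_rowSpan_iff.1 h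
  have hsupp : StrandSupp (k := k) (m := m) 1 J
      (fun a => ∑ x ∈ J, if a = {x} then ζ x else 0) := by
    intro a ha
    refine Finset.sum_eq_zero fun x hx => if_neg ?_
    rintro rfl
    exact ha ⟨Multiset.card_singleton x, fun y hy => by rwa [Multiset.mem_singleton.1 hy]⟩
  refine ⟨_, hsupp, ?_⟩
  ext1 b
  by_cases hb : b = 0
  · subst hb
    rw [← hζ, strandD_apply]
    have : ∀ i : Fin n, (∑ x ∈ J, if i ::ₘ (0 : Multiset (Fin n)) = {x} then ζ x else 0) =
        if i ∈ J then ζ i else 0 := by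
      intro i
      simp [Multiset.singleton_inj]
    simp only [this]
    rw [← Finset.sum_subset (Finset.subset_univ J)]
    · exact Finset.sum_congr rfl fun i hi => by rw [if_pos hi]
    · intro i _ hi
      rw [if_neg hi, map_zero]
  · have hc : ¬ (b.card = 0 ∧ ∀ x ∈ b, x ∈ J) := fun h => hb (Multiset.card_eq_zero.1 h.1)
    rw [hω b hc, hsupp.strandD b hc]

theorem strandD_exact (J : Finset (Fin n)) {q : ℕ} (hq : q + J.card ≤ m + 1) (j : ℕ)
    (ω : Multiset (Fin n) → Finset (Fin m) → MvPolynomial (Fin n × Fin m) k)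
    (hω : StrandSupp (j + 1) J ω) (hdeg : ∀ a, DegLT q (ω a)) (h : strandD k n m ω = 0) :
    ∃ ξ, StrandSupp (j + 2) J ξ ∧ strandD k n m ξ = ω := by
  classical
  induction J using Finset.induction_on generalizing j ω with
  | empty =>
    refine ⟨0, fun a _ => rfl, ?_⟩
    rw [map_zero]
    ext1 a
    refine (hω a ?_).symm
    rintro ⟨h1, h2⟩
    obtain ⟨x, hx⟩ := Multiset.card_pos_iff_exists_mem.1 (by omega : 0 < a.card)
    exact absurd (h2 x hx) (Finset.notMem_empty x)
  | insert i J hi ihJ =>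
    rw [Finset.card_insert_of_notMem hi] at hq
    have lift : ∀ (j : ℕ)
        (ω : Multiset (Fin n) → Finset (Fin m) → MvPolynomial (Fin n × Fin m) k),
        StrandSupp (j + 1) (insert i J) ω → (∀ a, DegLT q (ω a)) → strandD k n m ω = 0 →
        (∃ ξ, StrandSupp (j + 1) (insert i J) ξ ∧ strandD k n m ξ = fun a => ω (i ::ₘ a)) →
        ∃ ξ, StrandSupp (j + 2) (insert i J) ξ ∧ strandD k n m ξ = ω := by
      rintro j ω hω hdeg h ⟨ξ, hξ, hdξ⟩
      set ρ : Multiset (Fin n) → Finset (Fin m) → MvPolynomial (Fin n × Fin m) k :=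
        fun a => if i ∈ a then cardFilter (· < q - 1) (ξ (a.erase i)) else 0 with hρ
      have hρi : ∀ a, ρ (i ::ₘ a) = cardFilter (· < q - 1) (ξ a) := fun a => by
        simp only [hρ, Multiset.mem_cons_self, if_true, Multiset.erase_cons_head]
      have hρs : StrandSupp (j + 2) (insert i J) ρ := by
        intro a ha
        by_cases hia : i ∈ a
        · obtain ⟨b, rfl⟩ := Multiset.exists_cons_of_mem hia
          rw [hρi, hξ, map_zero]
          rintro ⟨h1, h2⟩
          refine ha ⟨by rw [Multiset.card_cons, h1], fun x hx => ?_⟩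
          rcases Multiset.mem_cons.1 hx with rfl | hx
          · exact Finset.mem_insert_self _ _
          · exact h2 x hx
        · simp only [hρ, hia, if_false]
      have hdρi : ∀ b, strandD k n m ρ (i ::ₘ b) = ω (i ::ₘ b) := by
        intro b
        have h1 := congrFun (cardFilter_strandD (k := k) q ξ) b
        rw [hdξ] at h1
        rw [← (hdeg (i ::ₘ b)).cardFilter_eq, h1, strandD_apply, strandD_apply]
        refine Finset.sum_congr rfl fun x _ => ?_
        rw [Multiset.cons_swap, hρi]
      have hρdeg : ∀ a, DegLT (q - 1) (ρ a) := by
        intro a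
        simp only [hρ]
        split_ifs
        · exact degLT_cardFilter _ _
        · exact fun _ _ => rfl
      have hdρdeg : ∀ b, DegLT q (strandD k n m ρ b) := by
        intro b
        have h1 := congrFun (cardFilter_strandD (k := k) q ρ) b
        simp only [(hρdeg _).cardFilter_eq] at h1
        rw [← h1]
        exact degLT_cardFilter _ _
      obtain ⟨τ, hτ, hdτ⟩ := ihJ (by omega) j (ω - strandD k n m ρ) (by
        intro a ha
        rw [Pi.sub_apply, sub_eq_zero]
        by_cases hia : i ∈ a
        · obtain ⟨b, rfl⟩ := Multiset.exists_cons_of_mem hia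
          exact (hdρi b).symm
        · have hc : ¬ (a.card = j + 1 ∧ ∀ x ∈ a, x ∈ insert i J) := by
            rintro ⟨h1, h2⟩
            refine ha ⟨h1, fun x hx => ?_⟩
            exact Finset.mem_of_mem_insert_of_ne (h2 x hx) (ne_of_mem_of_not_mem hx hia)
          rw [hω a hc, hρs.strandD a hc]) (by
        intro a S hS
        rw [Pi.sub_apply, Pi.sub_apply, hdeg a S hS, hdρdeg a S hS, sub_zero]) (by
        rw [map_sub, h, strandD_strandD, sub_zero])
      refine ⟨τ + ρ, ?_, by rw [map_add, hdτ, sub_add_cancel]⟩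
      intro a ha
      rw [Pi.add_apply, hρs a ha, hτ, add_zero]
      rintro ⟨h1, h2⟩
      exact ha ⟨h1, fun x hx => Finset.mem_insert_of_mem (h2 x hx)⟩
    have shift : ∀ (j : ℕ)
        (ω : Multiset (Fin n) → Finset (Fin m) → MvPolynomial (Fin n × Fin m) k),
        StrandSupp (j + 1) (insert i J) ω →
        StrandSupp j (insert i J) fun a => ω (i ::ₘ a) := by
      intro j ω hω a ha
      refine hω _ ?_
      rintro ⟨h1, h2⟩
      rw [Multiset.card_cons, add_left_inj] at h1
      exact ha ⟨h1, fun x hx => h2 x (Multiset.mem_cons_of_mem hx)⟩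
    induction j generalizing ω with
    | zero =>
      refine lift 0 ω hω hdeg h (exists_strandD_eq_of_mem_rowSpan (shift 0 ω hω) ?_)
      refine mem_rowSpan_of_rowWedge_mem J.card J rfl i hi q (by omega) _ (hdeg _) ?_
      have h0 := congrFun h 0
      rw [strandD_apply, ← Finset.sum_subset (Finset.subset_univ (insert i J)),
        Finset.sum_insert hi] at h0
      · rw [eq_neg_of_add_eq_zero_left h0]
        exact Submodule.neg_mem _ (Submodule.sum_mem _ fun x hx => rowWedge_mem_rowSpan hx _)
      · intro x _ hx
        rw [hω, map_zero]
        exact fun hc => hx (hc.2 x (Multiset.mem_cons_self x 0))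
    | succ j ihj =>
      refine lift (j + 1) ω hω hdeg h (ihj _ (shift _ ω hω) (fun a => hdeg _) ?_)
      ext1 b
      have h0 := congrFun h (i ::ₘ b)
      rw [strandD_apply] at h0 ⊢
      refine Eq.trans ?_ h0
      exact Finset.sum_congr rfl fun x _ => by rw [Multiset.cons_swap]

end Strand

noncomputable section Coordinates

variable {k : Type} [CommRing k] {n m : ℕ}

/-- The basis of the part of the strand of polynomial degree `j` that occurs in the resolution. -/
abbrev StrandIdx (n m j : ℕ) : Type :=
  Sym (Fin n) j × {S : Finset (Fin m) // S.card + (n + 1 + j) = m}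

/-- Extend coordinates by zero. -/
def strandExt (k : Type) [CommRing k] (n m j : ℕ) :
    (StrandIdx n m j → MvPolynomial (Fin n × Fin m) k) →ₗ[MvPolynomial (Fin n × Fin m) k]
      (Multiset (Fin n) → Finset (Fin m) → MvPolynomial (Fin n × Fin m) k) where
  toFun f a S := if h : a.card = j ∧ S.card + (n + 1 + j) = m then
    f (⟨a, h.1⟩, ⟨S, h.2⟩) else 0
  map_add' f g := by
    ext1 a
    ext1 S
    simp only [Pi.add_apply]
    split_ifs <;> simp
  map_smul' c f := by
    ext1 a
    ext1 S
    simp only [Pi.smul_apply, RingHom.id_apply]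
    split_ifs <;> simp

/-- Restrict to coordinates. -/
def strandRes (k : Type) [CommRing k] (n m j : ℕ) :
    (Multiset (Fin n) → Finset (Fin m) → MvPolynomial (Fin n × Fin m) k)
      →ₗ[MvPolynomial (Fin n × Fin m) k]
      (StrandIdx n m j → MvPolynomial (Fin n × Fin m) k) where
  toFun ω p := ω p.1.1 p.2.1
  map_add' _ _ := rfl
  map_smul' _ _ := rfl

theorem strandExt_apply (j : ℕ) (f : StrandIdx n m j → MvPolynomial (Fin n × Fin m) k)
    (a : Multiset (Fin n)) (S : Finset (Fin m)) :
    strandExt k n m j f a S = if h : a.card = j ∧ S.card + (n + 1 + j) = m then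
      f (⟨a, h.1⟩, ⟨S, h.2⟩) else 0 := rfl

theorem strandRes_strandExt (j : ℕ) (f : StrandIdx n m j → MvPolynomial (Fin n × Fin m) k) :
    strandRes k n m j (strandExt k n m j f) = f := by
  ext1 ⟨⟨a, ha⟩, ⟨S, hS⟩⟩
  change strandExt k n m j f a S = _
  rw [strandExt_apply, dif_pos ⟨ha, hS⟩]

theorem strandExt_strandRes (j : ℕ)
    {ω : Multiset (Fin n) → Finset (Fin m) → MvPolynomial (Fin n × Fin m) k}
    (hω : StrandSupp j Finset.univ ω) :
    strandExt k n m j (strandRes k n m j ω) =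
      fun a => cardFilter (fun c => c + (n + 1 + j) = m) (ω a) := by
  ext1 a
  ext1 S
  rw [strandExt_apply, cardFilter_apply]
  by_cases ha : a.card = j
  · by_cases hS : S.card + (n + 1 + j) = m
    · rw [dif_pos ⟨ha, hS⟩, if_pos hS]
      rfl
    · rw [dif_neg fun h => hS h.2, if_neg hS]
  · rw [dif_neg fun h => ha h.1, hω a fun h => ha h.1]
    simp

theorem strandSupp_strandExt (j : ℕ) (f : StrandIdx n m j → MvPolynomial (Fin n × Fin m) k) :
    StrandSupp j Finset.univ (strandExt k n m j f) := by
  intro a ha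
  ext1 S
  rw [strandExt_apply, dif_neg fun h => ha ⟨h.1, fun x _ => Finset.mem_univ x⟩]
  rfl

theorem cardFilter_strandExt (j : ℕ) (f : StrandIdx n m j → MvPolynomial (Fin n × Fin m) k)
    (a : Multiset (Fin n)) :
    cardFilter (fun c => c + (n + 1 + j) = m) (strandExt k n m j f a) =
      strandExt k n m j f a := by
  rw [← congrFun (strandExt_strandRes j (strandSupp_strandExt j f)) a, strandRes_strandExt]

theorem degLT_strandExt (j : ℕ) (f : StrandIdx n m j → MvPolynomial (Fin n × Fin m) k)
    (a : Multiset (Fin n)) : DegLT (m - n) (strandExt k n m j f a) := by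
  intro S hS
  rw [strandExt_apply, dif_neg]
  rintro ⟨_, h⟩
  omega

theorem cardFilter_eq_strandD (j : ℕ)
    (ω : Multiset (Fin n) → Finset (Fin m) → MvPolynomial (Fin n × Fin m) k) :
    (fun b => cardFilter (fun c => c + (n + 1 + j) = m) (strandD k n m ω b)) =
      strandD k n m fun a => cardFilter (fun c => c + (n + 1 + (j + 1)) = m) (ω a) := by
  ext1 b
  simp only [strandD_apply, map_sum]
  exact Finset.sum_congr rfl fun i _ => cardFilter_wedge _ _ (fun c => by omega) _ _

/-- The linear differentials of the resolution. -/
def strandMap (k : Type) [CommRing k] (n m j : ℕ) :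
    (StrandIdx n m (j + 1) → MvPolynomial (Fin n × Fin m) k)
      →ₗ[MvPolynomial (Fin n × Fin m) k]
      (StrandIdx n m j → MvPolynomial (Fin n × Fin m) k) :=
  strandRes k n m j ∘ₗ strandD k n m ∘ₗ strandExt k n m (j + 1)

theorem strandMap_apply (j : ℕ)
    (f : StrandIdx n m (j + 1) → MvPolynomial (Fin n × Fin m) k) :
    strandMap k n m j f = strandRes k n m j (strandD k n m (strandExt k n m (j + 1) f)) := rfl

theorem strandExt_strandMap (j : ℕ)
    (f : StrandIdx n m (j + 1) → MvPolynomial (Fin n × Fin m) k) :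
    strandExt k n m j (strandMap k n m j f) = strandD k n m (strandExt k n m (j + 1) f) := by
  rw [strandMap_apply, strandExt_strandRes _ (strandSupp_strandExt _ f).strandD,
    cardFilter_eq_strandD]
  simp only [cardFilter_strandExt]

theorem exists_strandMap_eq (j : ℕ) {f : StrandIdx n m j → MvPolynomial (Fin n × Fin m) k}
    {ξ : Multiset (Fin n) → Finset (Fin m) → MvPolynomial (Fin n × Fin m) k}
    (hξ : StrandSupp (j + 1) Finset.univ ξ) (h : strandD k n m ξ = strandExt k n m j f) :
    ∃ g, strandMap k n m j g = f := by
  refine ⟨strandRes k n m (j + 1) ξ, ?_⟩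
  rw [strandMap_apply, strandExt_strandRes _ hξ, ← cardFilter_eq_strandD, h]
  simp only [cardFilter_strandExt]
  exact strandRes_strandExt j f

theorem strandMap_exact (hnm : n ≤ m) (j : ℕ) :
    Function.Exact (strandMap k n m (j + 1)) (strandMap k n m j) := by
  intro f
  constructor
  · intro hf
    have h : strandD k n m (strandExt k n m (j + 1) f) = 0 := by
      rw [← strandExt_strandMap, hf, map_zero]
    obtain ⟨ξ, hξ, hd⟩ := strandD_exact Finset.univ (q := m - n)
      (by rw [Finset.card_univ, Fintype.card_fin]; omega) j _ (strandSupp_strandExt _ f)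
      (degLT_strandExt _ f) h
    exact exists_strandMap_eq (j + 1) hξ hd
  · rintro ⟨g, rfl⟩
    rw [strandMap_apply, strandExt_strandMap, strandD_strandD, map_zero]

/-- The identification of the exterior elements of codegree one with vectors. -/
def coVec (k : Type) [CommRing k] (n m : ℕ) :
    (Finset (Fin m) → MvPolynomial (Fin n × Fin m) k) →ₗ[MvPolynomial (Fin n × Fin m) k]
      (Fin m → MvPolynomial (Fin n × Fin m) k) where
  toFun ω j := sgn _ j Finset.univ * ω (Finset.univ.erase j)
  map_add' ω η := by
    ext1 j
    simp [mul_add]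
  map_smul' a ω := by
    ext1 j
    simp only [Pi.smul_apply, smul_eq_mul, RingHom.id_apply]
    ring

theorem coVec_apply (ω : Finset (Fin m) → MvPolynomial (Fin n × Fin m) k) (j : Fin m) :
    coVec k n m ω j = sgn _ j Finset.univ * ω (Finset.univ.erase j) := rfl

theorem rowWedge_univ (i : Fin n) (ω : Finset (Fin m) → MvPolynomial (Fin n × Fin m) k) :
    rowWedge k i ω Finset.univ = ∑ j, X (i, j) * coVec k n m ω j := by
  rw [rowWedge, wedge_apply]
  refine Finset.sum_congr rfl fun j _ => ?_
  rw [coVec_apply]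
  ring

theorem exists_eq_univ_erase {S : Finset (Fin m)} (hS : S.card + 1 = m) :
    ∃ j, S = Finset.univ.erase j := by
  have h : (Sᶜ).card = 1 := by
    rw [Finset.card_compl, Fintype.card_fin]
    omega
  obtain ⟨j, hj⟩ := Finset.card_eq_one.1 h
  refine ⟨j, ?_⟩
  rw [← compl_compl S, hj]
  ext x
  simp

theorem cardFilter_eq_zero_of_coVec_eq_zero
    {ω : Finset (Fin m) → MvPolynomial (Fin n × Fin m) k} (h : coVec k n m ω = 0) :
    cardFilter (fun c => c + 1 = m) ω = 0 := by
  ext1 S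
  rw [cardFilter_apply]
  split_ifs with hS
  · obtain ⟨j, rfl⟩ := exists_eq_univ_erase hS
    have hj := congrFun h j
    rw [coVec_apply] at hj
    rw [← one_mul (ω _), ← sgn_mul_self j Finset.univ, mul_assoc, hj]
    simp
  · rfl

theorem exists_coVec_eq (g : Fin m → MvPolynomial (Fin n × Fin m) k) :
    ∃ ω, cardFilter (fun c => c + 1 = m) ω = ω ∧ coVec k n m ω = g := by
  classical
  refine ⟨fun S => ∑ j, if S = Finset.univ.erase j then sgn _ j Finset.univ * g j else 0,
    ?_, ?_⟩
  · ext1 S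
    rw [cardFilter_apply]
    split_ifs with hS
    · rfl
    · refine (Finset.sum_eq_zero fun j _ => if_neg ?_).symm
      rintro rfl
      refine hS ?_
      rw [Finset.card_erase_add_one (Finset.mem_univ j), Finset.card_univ, Fintype.card_fin]
  · ext1 j
    have hinj : ∀ x : Fin m, Finset.univ.erase j = Finset.univ.erase x ↔ j = x := fun x =>
      (Finset.erase_injOn Finset.univ).eq_iff (by simp) (by simp)
    rw [coVec_apply]
    simp only [hinj]
    rw [Finset.sum_ite_eq, if_pos (Finset.mem_univ j), ← mul_assoc, sgn_mul_self, one_mul]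

theorem cardFilter_eq_rowProd (L : List (Fin n)) (e : ℕ)
    (ω : Finset (Fin m) → MvPolynomial (Fin n × Fin m) k) :
    cardFilter (fun c => c + e = m) (rowProd k L ω) =
      rowProd k L (cardFilter (fun c => c + (L.length + e) = m) ω) := by
  induction L generalizing e with
  | nil => simp [rowProd]
  | cons l L ih =>
    rw [rowProd_cons, rowProd_cons, rowWedge,
      cardFilter_wedge (fun c => c + (e + 1) = m) _ (fun c => by omega), ih]
    simp only [List.length_cons, Nat.add_assoc, Nat.add_comm 1]

/-- The differential given by the maximal minors. -/
def minorMap (k : Type) [CommRing k] (n m : ℕ) :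
    (StrandIdx n m 0 → MvPolynomial (Fin n × Fin m) k) →ₗ[MvPolynomial (Fin n × Fin m) k]
      (Fin m → MvPolynomial (Fin n × Fin m) k) :=
  coVec k n m ∘ₗ rowProd k (List.finRange n) ∘ₗ LinearMap.proj 0 ∘ₗ strandExt k n m 0

theorem minorMap_apply (f : StrandIdx n m 0 → MvPolynomial (Fin n × Fin m) k) :
    minorMap k n m f = coVec k n m (rowProd k (List.finRange n) (strandExt k n m 0 f 0)) := rfl

theorem strandMap_minorMap_exact (hnm : n ≤ m) :
    Function.Exact (strandMap k n m 0) (minorMap k n m) := by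
  intro f
  constructor
  · intro hf
    rw [minorMap_apply] at hf
    have h := cardFilter_eq_zero_of_coVec_eq_zero hf
    rw [cardFilter_eq_rowProd, List.length_finRange] at h
    have h' := cardFilter_strandExt 0 f 0
    rw [add_zero] at h'
    rw [h'] at h
    have hmem := mem_rowSpan_of_rowProd_eq_zero (List.nodup_finRange n) (q := m - n)
      (by rw [List.length_finRange]; omega) (degLT_strandExt 0 f 0) h
    rw [List.toFinset_finRange] at hmem
    obtain ⟨ξ, hξ, hd⟩ := exists_strandD_eq_of_mem_rowSpan (strandSupp_strandExt 0 f) hmem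
    exact exists_strandMap_eq 0 hξ hd
  · rintro ⟨g, rfl⟩
    rw [minorMap_apply, strandExt_strandMap, strandD_apply, map_sum, Finset.sum_eq_zero,
      map_zero]
    exact fun i _ => rowProd_rowWedge_of_mem (List.mem_finRange i) _

theorem minorMap_exact (g : Fin m → MvPolynomial (Fin n × Fin m) k) :
    (∀ i, ∑ j, X (i, j) * g j = 0) ↔ g ∈ Set.range (minorMap k n m) := by
  constructor
  · intro hg
    obtain ⟨ω, hω, rfl⟩ := exists_coVec_eq g
    have hdeg : DegLT m ω := by
      intro S hS
      rw [← hω, cardFilter_apply, if_neg (by omega)]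
    have hz : ∀ i ∈ List.finRange n, rowWedge k i ω = 0 := by
      intro i _
      ext1 S
      by_cases hS : S.card = m
      · have : S = Finset.univ := by
          rw [← Finset.card_eq_iff_eq_univ, hS, Fintype.card_fin]
        rw [this, rowWedge_univ, hg i]
        rfl
      · rw [← hω, rowWedge, ← cardFilter_wedge _ (fun c => c = m) (fun c => Iff.rfl),
          cardFilter_apply, if_neg hS]
        rfl
    obtain ⟨η, hη⟩ := mem_range_rowProd (List.nodup_finRange n) le_rfl hdeg hz
    refine ⟨strandRes k n m 0 (fun a => if a = 0 then η else 0), ?_⟩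
    rw [minorMap_apply, strandExt_strandRes]
    · beta_reduce
      rw [if_pos rfl]
      have h := cardFilter_eq_rowProd (k := k) (m := m) (List.finRange n) 1 η
      rw [List.length_finRange] at h
      simp only [add_zero]
      rw [← h, hη, hω]
    · intro a ha
      refine if_neg fun h0 => ha ?_
      subst h0
      simp
  · rintro ⟨f, rfl⟩ i
    rw [minorMap_apply, ← rowWedge_univ]
    have h := rowProd_rowWedge_of_mem (k := k) (List.mem_finRange i) (strandExt k n m 0 f 0)
    rw [rowProd_rowWedge] at h
    have h2 := congrArg (fun v => (-1 : MvPolynomial (Fin n × Fin m) k) ^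
      (List.finRange n).length • v) h
    simp only [smul_smul, smul_zero, ← mul_pow, neg_mul_neg, one_mul, one_pow, one_smul] at h2
    rw [h2]
    rfl

end Coordinates

noncomputable section Resolution

variable {k : Type} [CommRing k] {n m : ℕ}

theorem isHomogeneous_sgn (j : Fin m) (S : Finset (Fin m)) :
    (sgn (MvPolynomial (Fin n × Fin m) k) j S).IsHomogeneous 0 := by
  rw [sgn]
  simpa using ((isHomogeneous_one (Fin n × Fin m) k).neg).pow (S.filter (· < j)).card

theorem isHomogeneous_rowWedge (i : Fin n) {d : ℕ}
    {ω : Finset (Fin m) → MvPolynomial (Fin n × Fin m) k} (hω : ∀ S, (ω S).IsHomogeneous d)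
    (S : Finset (Fin m)) : (rowWedge k i ω S).IsHomogeneous (d + 1) := by
  rw [rowWedge, wedge_apply]
  refine IsHomogeneous.sum _ _ _ fun j _ => ?_
  have h := ((isHomogeneous_sgn (k := k) (n := n) j S).mul (isHomogeneous_X k (i, j))).mul
    (hω (S.erase j))
  rwa [zero_add, add_comm 1 d] at h

theorem isHomogeneous_rowProd (L : List (Fin n)) {d : ℕ}
    {ω : Finset (Fin m) → MvPolynomial (Fin n × Fin m) k} (hω : ∀ S, (ω S).IsHomogeneous d)
    (S : Finset (Fin m)) : (rowProd k L ω S).IsHomogeneous (d + L.length) := by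
  induction L generalizing S with
  | nil => exact hω S
  | cons i L ih =>
    rw [rowProd_cons, List.length_cons, ← add_assoc]
    exact isHomogeneous_rowWedge i ih S

theorem isHomogeneous_strandExt (j : ℕ) {d : ℕ}
    {f : StrandIdx n m j → MvPolynomial (Fin n × Fin m) k} (hf : ∀ c, (f c).IsHomogeneous d)
    (a : Multiset (Fin n)) (S : Finset (Fin m)) :
    (strandExt k n m j f a S).IsHomogeneous d := by
  rw [strandExt_apply]
  split_ifs
  · exact hf _
  · exact isHomogeneous_zero _ _ _

theorem isHomogeneous_strandMap (j : ℕ) {d : ℕ}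
    {f : StrandIdx n m (j + 1) → MvPolynomial (Fin n × Fin m) k}
    (hf : ∀ c, (f c).IsHomogeneous d) (r : StrandIdx n m j) :
    (strandMap k n m j f r).IsHomogeneous (d + 1) := by
  change (strandD k n m (strandExt k n m (j + 1) f) r.1.1 r.2.1).IsHomogeneous (d + 1)
  rw [strandD_apply, Finset.sum_apply]
  exact IsHomogeneous.sum _ _ _ fun i _ =>
    isHomogeneous_rowWedge i (isHomogeneous_strandExt (j + 1) hf _) _

theorem isHomogeneous_minorMap {d : ℕ}
    {f : StrandIdx n m 0 → MvPolynomial (Fin n × Fin m) k}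
    (hf : ∀ c, (f c).IsHomogeneous d) (r : Fin m) :
    (minorMap k n m f r).IsHomogeneous (d + n) := by
  rw [minorMap_apply, coVec_apply]
  have h := (isHomogeneous_sgn (k := k) (n := n) r Finset.univ).mul
    (isHomogeneous_rowProd (List.finRange n) (isHomogeneous_strandExt 0 hf 0)
      (Finset.univ.erase r))
  rwa [List.length_finRange, zero_add] at h

/-- The index set of the basis of the `i`-th module of the resolution. -/
def ResIdx (n m : ℕ) : ℕ → Type
  | 0 => Fin n
  | 1 => Fin m
  | j + 2 => StrandIdx n m j

instance resIdxFintype (n m : ℕ) : (i : ℕ) → Fintype (ResIdx n m i)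
  | 0 => inferInstanceAs (Fintype (Fin n))
  | 1 => inferInstanceAs (Fintype (Fin m))
  | j + 2 => inferInstanceAs (Fintype (StrandIdx n m j))

instance resIdxDecidableEq (n m i : ℕ) : DecidableEq (ResIdx n m i) := Classical.decEq _

/-- The differentials of the resolution. -/
def resMap (k : Type) [Field k] (n m : ℕ) : (i : ℕ) →
    (ResIdx n m (i + 1) → MvPolynomial (Fin n × Fin m) k) →ₗ[MvPolynomial (Fin n × Fin m) k]
      (ResIdx n m i → MvPolynomial (Fin n × Fin m) k)
  | 0 => (genMatrix k n m).mulVecLin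
  | 1 => minorMap k n m
  | j + 2 => strandMap k n m j

theorem resMap_exact (k : Type) [Field k] (hnm : n ≤ m) :
    ∀ i, Function.Exact (resMap k n m (i + 1)) (resMap k n m i)
  | 0 => fun g => by
    refine Iff.trans ?_ (minorMap_exact (k := k) g)
    exact funext_iff
  | 1 => strandMap_minorMap_exact hnm
  | j + 2 => strandMap_exact hnm j

theorem isHomogeneous_resMap (k : Type) [Field k] :
    ∀ (i : ℕ) (f : ResIdx n m (i + 1) → MvPolynomial (Fin n × Fin m) k),
      (∀ c, (f c).IsHomogeneous 0) → ∀ r,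
      (resMap k n m i f r).IsHomogeneous (degD n (i + 1) - degD n i)
  | 0, f, hf, r => by
    change (∑ j : Fin m, (X ((r, j) : Fin n × Fin m) : MvPolynomial (Fin n × Fin m) k) *
      (f j : MvPolynomial (Fin n × Fin m) k)).IsHomogeneous 1
    exact IsHomogeneous.sum _ _ _ fun j _ => (isHomogeneous_X k _).mul (hf j)
  | 1, f, hf, r => by
    have h : degD n (1 + 1) - degD n 1 = 0 + n := by simp [degD]
    rw [h]
    exact isHomogeneous_minorMap hf r
  | j + 2, f, hf, r => by
    have h : degD n (j + 2 + 1) - degD n (j + 2) = 0 + 1 := by simp [degD]; omega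
    rw [h]
    exact isHomogeneous_strandMap j hf r

theorem degD_sub_pos (hn : 1 ≤ n) (i : ℕ) : degD n (i + 1) - degD n i ≠ 0 := by
  match i with
  | 0 => simp [degD]
  | 1 => simp [degD]; omega
  | j + 2 => simp [degD]; omega

theorem card_codegree_subsets (m c : ℕ) :
    Fintype.card {S : Finset (Fin m) // S.card + c = m} = m.choose c := by
  rw [Fintype.card_subtype]
  by_cases hc : c ≤ m
  · have h : (Finset.univ.filter fun S : Finset (Fin m) => S.card + c = m) =
        Finset.powersetCard (m - c) Finset.univ := by
      ext S
      simp only [Finset.mem_filter, Finset.mem_univ, true_and, Finset.mem_powersetCard,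
        Finset.subset_univ]
      omega
    rw [h, Finset.card_powersetCard, Finset.card_univ, Fintype.card_fin, Nat.choose_symm hc]
  · rw [Nat.choose_eq_zero_of_lt (by omega), Finset.card_eq_zero,
      Finset.filter_eq_empty_iff]
    intro S _
    omega

theorem card_resIdx (hn : 1 ≤ n) {l : ℕ} (hl : 1 ≤ l) :
    ∀ i, Fintype.card (ResIdx n (l * n) i) = bettiB n l i
  | 0 => Fintype.card_fin n
  | 1 => Fintype.card_fin (l * n)
  | j + 2 => by
    obtain ⟨l, rfl⟩ : ∃ l', l = l' + 1 := ⟨l - 1, by omega⟩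
    have h : Fintype.card (ResIdx n ((l + 1) * n) (j + 2)) =
        (n + j - 1).choose j * ((l + 1) * n).choose (n + 1 + j) := by
      change Fintype.card (StrandIdx n ((l + 1) * n) j) = _
      rw [Fintype.card_prod, card_codegree_subsets, Sym.card_sym_eq_choose, Fintype.card_fin]
    rw [h, bettiB, if_neg (by omega), if_neg (by omega)]
    split_ifs with hj
    · rw [mul_comm, ← Nat.choose_symm (by omega : j ≤ n + j - 1)]
      congr 2 <;> omega
    · rw [Nat.choose_eq_zero_of_lt (k := n + 1 + j), mul_zero]
      rw [Nat.add_sub_cancel] at hj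
      rw [add_mul, one_mul]
      omega

/-- The bijection numbering the basis of the `i`-th module of the resolution. -/
def resEquiv (hn : 1 ≤ n) {l : ℕ} (hl : 1 ≤ l) (i : ℕ) :
    Fin (bettiB n l i) ≃ ResIdx n (l * n) i :=
  (Fintype.equivFinOfCardEq (card_resIdx hn hl i)).symm

/-- The matrices of the differentials of the resolution. -/
def resMatrix (k : Type) [Field k] (hn : 1 ≤ n) {l : ℕ} (hl : 1 ≤ l) (i : ℕ) :
    Matrix (Fin (bettiB n l i)) (Fin (bettiB n l (i + 1)))
      (MvPolynomial (Fin n × Fin (l * n)) k) := fun r c =>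
  resMap k n (l * n) i (Pi.single (resEquiv hn hl (i + 1) c) 1) (resEquiv hn hl i r)

theorem resMatrix_mulVecLin (k : Type) [Field k] (hn : 1 ≤ n) {l : ℕ} (hl : 1 ≤ l) (i : ℕ)
    (v : Fin (bettiB n l (i + 1)) → MvPolynomial (Fin n × Fin (l * n)) k) :
    (resMatrix k hn hl i).mulVecLin v =
      resMap k n (l * n) i (v ∘ (resEquiv hn hl (i + 1)).symm) ∘ resEquiv hn hl i := by
  ext1 r
  have hv : v ∘ (resEquiv hn hl (i + 1)).symm =
      ∑ c, v c • Pi.single (resEquiv hn hl (i + 1) c) 1 := by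
    ext1 x
    rw [Finset.sum_apply]
    simp only [Pi.smul_apply, smul_eq_mul, Pi.single_apply, mul_ite, mul_one, mul_zero,
      Function.comp_apply]
    rw [Finset.sum_eq_single ((resEquiv hn hl (i + 1)).symm x)]
    · rw [if_pos (by simp)]
    · rintro c _ hc
      rw [if_neg]
      rintro rfl
      simp at hc
    · simp
  rw [hv, map_sum, Function.comp_apply, Finset.sum_apply]
  simp only [map_smul, Pi.smul_apply, smul_eq_mul]
  change ∑ c, resMatrix k hn hl i r c * v c = _
  exact Finset.sum_congr rfl fun c _ => mul_comm (resMatrix k hn hl i r c) (v c)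

theorem resMatrix_exact (k : Type) [Field k] (hn : 1 ≤ n) {l : ℕ} (hl : 1 ≤ l) (i : ℕ) :
    Function.Exact (resMatrix k hn hl (i + 1)).mulVecLin (resMatrix k hn hl i).mulVecLin := by
  have hnm : n ≤ l * n := Nat.le_mul_of_pos_left n hl
  intro v
  have hex := resMap_exact k hnm i (v ∘ (resEquiv hn hl (i + 1)).symm)
  have h0 : (resMatrix k hn hl i).mulVecLin v = 0 ↔
      resMap k n (l * n) i (v ∘ (resEquiv hn hl (i + 1)).symm) = 0 := by
    rw [resMatrix_mulVecLin]
    exact ⟨fun h => (resEquiv hn hl i).surjective.injective_comp_right h, fun h => by rw [h]; rfl⟩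
  rw [h0, hex]
  constructor
  · rintro ⟨w, hw⟩
    refine ⟨w ∘ resEquiv hn hl (i + 2), ?_⟩
    rw [resMatrix_mulVecLin, Function.comp_assoc, Equiv.self_comp_symm, Function.comp_id, hw,
      Function.comp_assoc, Equiv.symm_comp_self, Function.comp_id]
  · rintro ⟨w, rfl⟩
    refine ⟨w ∘ (resEquiv hn hl (i + 2)).symm, ?_⟩
    rw [resMatrix_mulVecLin, Function.comp_assoc _ (resEquiv hn hl (i + 1)),
      Equiv.self_comp_symm, Function.comp_id]

/-- The augmentation of the resolution. -/
def resAug (k : Type) [Field k] (hn : 1 ≤ n) {l : ℕ} (hl : 1 ≤ l) :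
    (Fin (bettiB n l 0) → MvPolynomial (Fin n × Fin (l * n)) k)
      →ₗ[MvPolynomial (Fin n × Fin (l * n)) k] genCoker k n (l * n) :=
  Submodule.mkQ (LinearMap.range (genMatrix k n (l * n)).mulVecLin) ∘ₗ
    LinearMap.funLeft _ _ (resEquiv hn hl 0).symm

theorem resAug_surjective (k : Type) [Field k] (hn : 1 ≤ n) {l : ℕ} (hl : 1 ≤ l) :
    Function.Surjective (resAug k hn hl) := by
  rw [resAug, LinearMap.coe_comp]
  exact (Submodule.mkQ_surjective _).comp
    (LinearMap.funLeft_surjective_of_injective _ _ _ (resEquiv hn hl 0).symm.injective)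

theorem resAug_exact (k : Type) [Field k] (hn : 1 ≤ n) {l : ℕ} (hl : 1 ≤ l) :
    Function.Exact (resMatrix k hn hl 0).mulVecLin (resAug k hn hl) := by
  intro v
  have h0 : resAug k hn hl v = 0 ↔
      v ∘ (resEquiv hn hl 0).symm ∈ LinearMap.range (resMap k n (l * n) 0) :=
    Submodule.Quotient.mk_eq_zero _
  rw [h0]
  constructor
  · rintro ⟨w, hw⟩
    refine ⟨w ∘ resEquiv hn hl 1, ?_⟩
    rw [resMatrix_mulVecLin, Function.comp_assoc, Equiv.self_comp_symm, Function.comp_id]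
    rw [hw, Function.comp_assoc, Equiv.symm_comp_self, Function.comp_id]
  · rintro ⟨w, rfl⟩
    refine ⟨w ∘ (resEquiv hn hl 1).symm, ?_⟩
    rw [resMatrix_mulVecLin, Function.comp_assoc _ (resEquiv hn hl 0),
      Equiv.self_comp_symm, Function.comp_id]

theorem isHomogeneous_resMatrix (k : Type) [Field k] (hn : 1 ≤ n) {l : ℕ} (hl : 1 ≤ l) (i : ℕ)
    (r : Fin (bettiB n l i)) (c : Fin (bettiB n l (i + 1))) :
    (resMatrix k hn hl i r c).IsHomogeneous (degD n (i + 1) - degD n i) := by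
  refine isHomogeneous_resMap k i _ (fun x => ?_) _
  rw [Pi.single_apply]
  split_ifs
  · exact isHomogeneous_one _ _
  · exact isHomogeneous_zero _ _ _

theorem bettiB_last (hn : 1 ≤ n) {l : ℕ} (hl : 1 < l) :
    bettiB n l ((l - 1) * n + 1) = (l * n - 2).choose (n - 1) := by
  obtain ⟨l, rfl⟩ : ∃ l', l = l' + 1 := ⟨l - 1, by omega⟩
  have hln : 1 ≤ l * n := Nat.mul_pos (by omega) hn
  rw [bettiB, Nat.add_sub_cancel, if_neg (by omega), if_neg (by omega), if_pos le_rfl,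
    add_mul, one_mul]
  have h1 : n + (l * n + 1) - 1 = l * n + n := by omega
  have h2 : n + (l * n + 1) - 3 = l * n + n - 2 := by omega
  rw [h1, h2, Nat.choose_self, one_mul]

end Resolution

end GenericWedge

/-- The module `F = Rⁿ/⟨columns of the generic n × ln matrix⟩` has a
minimal graded free resolution `⋯ → R^{b_i}[-deg i] → ⋯ → R^{b_0} → F → 0` whose ranks are
the Betti numbers `b₀ = n`, `b₁ = ln`, `b_i = C(ln, n+i-1)·C(n+i-3, n-1)` for
`2 ≤ i ≤ (l-1)n+1` and `b_i = 0` for `i > (l-1)n+1`, with all generators of the `i`-th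
module concentrated in degree `0, 1, n+i-1` for `i = 0, 1, ≥2` respectively; the matrices of
the differentials have entries homogeneous of the appropriate degrees and with no constant
terms (minimality).  In particular, for `l > 1` the projective dimension of `F` is
`(l-1)n + 1` and the last Betti number is `C(ln-2, n-1)`. -/
theorem statement19 (k : Type) [Field k] (n l : ℕ) (hn : 1 ≤ n) (hl : 1 ≤ l) :
    (∃ (φ : (i : ℕ) → Matrix (Fin (bettiB n l i)) (Fin (bettiB n l (i + 1)))
        (MvPolynomial (Fin n × Fin (l * n)) k))
      (ε : (Fin (bettiB n l 0) → MvPolynomial (Fin n × Fin (l * n)) k)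
        →ₗ[MvPolynomial (Fin n × Fin (l * n))  k] genCoker k n (l * n)),
      Function.Surjective ε ∧
      Function.Exact ((φ 0).mulVecLin) ε ∧
      (∀ i, Function.Exact ((φ (i + 1)).mulVecLin) ((φ i).mulVecLin)) ∧
      (∀ i r c, (φ i r c).IsHomogeneous (degD n (i + 1) - degD n i)) ∧
      (∀ i r c, MvPolynomial.coeff 0 (φ i r c) = 0)) ∧
    (1 < l →
      bettiB n l ((l - 1) * n + 1) = (l * n - 2).choose (n - 1) ∧
      bettiB n l ((l - 1) * n + 1) ≠ 0) := by
  refine ⟨⟨GenericWedge.resMatrix k hn hl, GenericWedge.resAug k hn hl,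
    GenericWedge.resAug_surjective k hn hl, GenericWedge.resAug_exact k hn hl,
    GenericWedge.resMatrix_exact k hn hl, GenericWedge.isHomogeneous_resMatrix k hn hl,
    fun i r c => ?_⟩, fun hl' => ?_⟩
  · refine (GenericWedge.isHomogeneous_resMatrix k hn hl i r c).coeff_eq_zero ?_
    rw [map_zero]
    exact (GenericWedge.degD_sub_pos hn i).symm
  · rw [GenericWedge.bettiB_last hn hl']
    refine ⟨rfl, (Nat.choose_pos ?_).ne'⟩
    have := Nat.mul_le_mul_right n (show 2 ≤ l from hl')
    omega
end
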